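/- arXiv:2103.13796 — 11 statements merged into one kernel-verified Lean document; each statement's English description precedes it below -/
import Mathlib

section
/- Let A and B be discrete random variables with support cardinalities M_a and M_b respectively, and let Ĥ(A∣B) be the plug-in estimator of H(A∣B) based on N i.i.d. copies of (A,B). Then −(M_a−1)·M_b/N ≤ E[Ĥ(A∣B)] − H(A∣B) ≤ 0; in particular, the plug-in conditional entropy estimator is negatively biased, with bias at most (M_a−1)·M_b/N in absolute value. -/
open Finset

/-- Shannon entropy (in nats) of a probability mass function on a finite type. -/
noncomputable def entPMF {γ : Type*} [Fintype γ] (q : γ → ℝ) : ℝ :=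
  ∑ x : γ, Real.negMulLog (q x)

/-- Conditional Shannon entropy H(A ∣ B) of the first coordinate given the second,
for a joint pmf `p` on `α × β`, via the chain rule `H(A ∣ B) = H(A,B) - H(B)`. -/
noncomputable def condEntPMF {α β : Type*} [Fintype α] [Fintype β] (p : α × β → ℝ) : ℝ :=
  entPMF p - entPMF (fun b : β => ∑ a : α, p (a, b))

/-- The empirical joint distribution of a sequence of `N` samples. -/
noncomputable def empDist {α β : Type*} [DecidableEq α] [DecidableEq β] {N : ℕ}
    (s : Fin N → α × β) : α × β → ℝ :=
  fun ab => ((Finset.univ.filter (fun i => s i = ab)).card : ℝ) / N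

/-- The plug-in estimator of the conditional entropy H(A ∣ B), computed from `N` samples. -/
noncomputable def plugInEst {α β : Type*} [Fintype α] [Fintype β] [DecidableEq α]
    [DecidableEq β] {N : ℕ} (s : Fin N → α × β) : ℝ :=
  condEntPMF (empDist s)

/-- The probability weight of a particular sequence of `N` i.i.d. samples from `p`. -/
noncomputable def iidW {α β : Type*} {N : ℕ} (p : α × β → ℝ) (s : Fin N → α × β) : ℝ :=
  ∏ i, p (s i)

open Classical in
/-- The probability, under `N` i.i.d. samples from `p`, of the event `E`. -/
noncomputable def prIID {α β : Type*} [Fintype α] [Fintype β] {N : ℕ} (p : α × β → ℝ)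
    (E : (Fin N → α × β) → Prop) : ℝ :=
  ∑ s : Fin N → α × β, if E s then iidW p s else 0

open Classical in
/-- The support cardinality `M_a` of the first marginal of `p`. -/
noncomputable def suppA {α β : Type*} [Fintype α] [Fintype β] (p : α × β → ℝ) : ℕ :=
  (Finset.univ.filter (fun a : α => ∑ b : β, p (a, b) ≠ 0)).card

open Classical in
/-- The support cardinality `M_b` of the second marginal of `p`. -/
noncomputable def suppB {α β : Type*} [Fintype α] [Fintype β] (p : α × β → ℝ) : ℕ :=
  (Finset.univ.filter (fun b : β => ∑ a : α, p (a, b) ≠ 0)).card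


/-- counts -/
noncomputable def cnt {γ : Type*} [DecidableEq γ] {N : ℕ} (s : Fin N → γ) (x : γ) : ℝ :=
  ((Finset.univ.filter (fun i => s i = x)).card : ℝ)

lemma cnt_eq_sum {γ : Type*} [DecidableEq γ] {N : ℕ} (s : Fin N → γ) (x : γ) :
    cnt s x = ∑ i, if s i = x then (1 : ℝ) else 0 := by
  simp [cnt]

lemma cnt_pos {γ : Type*} [DecidableEq γ] {N : ℕ} (s : Fin N → γ) (i : Fin N) :
    0 < cnt s (s i) := by
  unfold cnt
  exact_mod_cast Finset.card_pos.mpr ⟨i, by simp⟩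

lemma cnt_nonneg {γ : Type*} [DecidableEq γ] {N : ℕ} (s : Fin N → γ) (x : γ) :
    0 ≤ cnt s x := by
  unfold cnt
  positivity

lemma exists_of_cnt_ne {γ : Type*} [DecidableEq γ] {N : ℕ} (s : Fin N → γ) (x : γ)
    (h : cnt s x ≠ 0) : ∃ i, s i = x := by
  by_contra hc
  push Not at hc
  apply h
  rw [cnt_eq_sum]
  simp [hc]

lemma sum_cnt {γ : Type*} [Fintype γ] [DecidableEq γ] {N : ℕ} (s : Fin N → γ) (g : γ → ℝ) :
    ∑ i, g (s i) = ∑ x, cnt s x * g x := by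
  simp only [cnt_eq_sum, Finset.sum_mul]
  rw [Finset.sum_comm]
  simp

lemma ent_cnt {γ : Type*} [Fintype γ] [DecidableEq γ] {N : ℕ} (hN : 0 < N) (s : Fin N → γ) :
    ∑ x, Real.negMulLog (cnt s x / N) = Real.log N - (∑ i, Real.log (cnt s (s i))) / N := by
  have hN' : (N : ℝ) ≠ 0 := by positivity
  have h1 : ∀ x, Real.negMulLog (cnt s x / N)
      = (cnt s x * Real.log N) / N - (cnt s x * Real.log (cnt s x)) / N := by
    intro x
    by_cases h : cnt s x = 0
    · simp [h]
    · rw [Real.negMulLog, Real.log_div h hN']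
      ring
  simp only [h1, Finset.sum_sub_distrib, ← Finset.sum_div]
  rw [← sum_cnt s (fun _ => Real.log N), ← sum_cnt s (fun x => Real.log (cnt s x))]
  simp
  field_simp

lemma sum_cnt_fst {α β : Type*} [Fintype α] [DecidableEq α] [DecidableEq β] {N : ℕ}
    (s : Fin N → α × β) (b : β) :
    ∑ a, cnt s (a, b) = cnt (fun i => (s i).2) b := by
  simp only [cnt_eq_sum]
  rw [Finset.sum_comm]
  refine Finset.sum_congr rfl fun i _ => ?_
  simp only [Prod.ext_iff, ite_and]
  simp

lemma plugIn_eq {α β : Type*} [Fintype α] [Fintype β] [DecidableEq α] [DecidableEq β] {N : ℕ}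
    (hN : 0 < N) (s : Fin N → α × β) :
    plugInEst s = (∑ i, (Real.log (cnt (fun i => (s i).2) (s i).2)
      - Real.log (cnt s (s i)))) / N := by
  have h1 := ent_cnt hN s
  have h2 := ent_cnt hN (fun i => (s i).2)
  have h3 : plugInEst s = ∑ x, Real.negMulLog (cnt s x / N)
      - ∑ b, Real.negMulLog (cnt (fun i => (s i).2) b / N) := by
    unfold plugInEst condEntPMF entPMF
    congr 1
    refine Finset.sum_congr rfl fun b _ => ?_
    rw [← sum_cnt_fst, Finset.sum_div]
    rfl
  rw [h3, h1, h2, Finset.sum_sub_distrib]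
  ring

lemma sum_iidW {α β : Type*} [Fintype α] [Fintype β] [DecidableEq α] [DecidableEq β]
    (p : α × β → ℝ) (hp1 : ∑ x : α × β, p x = 1) {N : ℕ} (i : Fin N) (g : α × β → ℝ) :
    ∑ s : Fin N → α × β, iidW p s * g (s i) = ∑ x, p x * g x := by
  have h := Finset.prod_univ_sum (fun _ : Fin N => (Finset.univ : Finset (α × β)))
    (fun k x => p x * if k = i then g x else 1)
  rw [Fintype.piFinset_univ] at h
  have h2 : ∀ s : Fin N → α × β,
      iidW p s * g (s i) = ∏ k, (p (s k) * if k = i then g (s k) else 1) := by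
    intro s
    rw [Finset.prod_mul_distrib]
    simp [iidW]
  simp only [h2]
  rw [← h, Finset.prod_eq_single i]
  · simp
  · intro k _ hk
    simp [hk, hp1]
  · simp

lemma condEnt_eq {α β : Type*} [Fintype α] [Fintype β] (p : α × β → ℝ) :
    condEntPMF p = ∑ x, p x * (Real.log (∑ a, p (a, x.2)) - Real.log (p x)) := by
  unfold condEntPMF entPMF
  simp only [mul_sub, Finset.sum_sub_distrib, Real.negMulLog]
  have : ∑ x : α × β, p x * Real.log (∑ a, p (a, x.2))
      = ∑ b, (∑ a, p (a, b)) * Real.log (∑ a, p (a, b)) := by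
    rw [Fintype.sum_prod_type_right]
    simp [Finset.sum_mul]
  rw [this]
  simp
  ring

lemma bias_eq {α β : Type*} [Fintype α] [Fintype β] [DecidableEq α] [DecidableEq β]
    (p : α × β → ℝ) (hp1 : ∑ x : α × β, p x = 1) (N : ℕ) (hN : 0 < N) :
    (∑ s : Fin N → α × β, iidW p s * plugInEst s) - condEntPMF p =
    ∑ s : Fin N → α × β, iidW p s * ((∑ i, (Real.log (cnt (fun i => (s i).2) (s i).2)
      - Real.log (cnt s (s i)) - (Real.log (∑ a, p (a, (s i).2)) - Real.log (p (s i))))) / N) := by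
  have h : condEntPMF p = ∑ s : Fin N → α × β, iidW p s *
      ((∑ i, (Real.log (∑ a, p (a, (s i).2)) - Real.log (p (s i)))) / N) := by
    simp only [← mul_div_assoc, Finset.mul_sum]
    rw [← Finset.sum_div, Finset.sum_comm]
    have hN' : (N : ℝ) ≠ 0 := by positivity
    rw [Finset.sum_congr rfl (fun i _ => sum_iidW p hp1 i
      (fun x => Real.log (∑ a, p (a, x.2)) - Real.log (p x)))]
    rw [← condEnt_eq]
    simp
    field_simp
  rw [h, ← Finset.sum_sub_distrib]
  refine Finset.sum_congr rfl fun s _ => ?_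
  rw [plugIn_eq hN, Finset.sum_sub_distrib (s := Finset.univ)
    (f := fun i => Real.log (cnt (fun i => (s i).2) (s i).2) - Real.log (cnt s (s i)))]
  ring

lemma iidW_nonneg {α β : Type*} (p : α × β → ℝ) (hp : ∀ x, 0 ≤ p x) {N : ℕ}
    (s : Fin N → α × β) : 0 ≤ iidW p s := Finset.prod_nonneg fun _ _ => hp _

lemma pos_of_W {α β : Type*} (p : α × β → ℝ) (hp : ∀ x, 0 ≤ p x) {N : ℕ}
    (s : Fin N → α × β) (h : iidW p s ≠ 0) (i : Fin N) : 0 < p (s i) := by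
  refine lt_of_le_of_ne (hp _) fun h0 => h ?_
  exact Finset.prod_eq_zero (Finset.mem_univ i) h0.symm

lemma marg_ge {α β : Type*} [Fintype α] (p : α × β → ℝ) (hp : ∀ x, 0 ≤ p x) (x : α × β) :
    p x ≤ ∑ a, p (a, x.2) :=
  Finset.single_le_sum (f := fun a => p (a, x.2)) (fun a _ => hp _) (Finset.mem_univ x.1)

lemma upper {α β : Type*} [Fintype α] [Fintype β] [DecidableEq α] [DecidableEq β]
    (p : α × β → ℝ) (hp : ∀ x, 0 ≤ p x) {N : ℕ} 
    (s : Fin N → α × β) (hs : iidW p s ≠ 0) :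
    ∑ i, (Real.log (cnt (fun i => (s i).2) (s i).2)
      - Real.log (cnt s (s i)) - (Real.log (∑ a, p (a, (s i).2)) - Real.log (p (s i)))) ≤ 0 := by
  set g : α × β → ℝ := fun x => cnt (fun i => (s i).2) x.2 * p x / (cnt s x * ∑ a, p (a, x.2))
    with hg
  have h1 : ∀ i, (Real.log (cnt (fun i => (s i).2) (s i).2)
      - Real.log (cnt s (s i)) - (Real.log (∑ a, p (a, (s i).2)) - Real.log (p (s i))))
      ≤ g (s i) - 1 := by
    intro i
    have a1 := cnt_pos s i
    have a2 := cnt_pos (fun i => (s i).2) i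
    have a3 := pos_of_W p hp s hs i
    have a4 := a3.trans_le (marg_ge p hp (s i))
    have := Real.log_le_sub_one_of_pos (x := g (s i)) (by simp only [hg]; positivity)
    refine le_trans (le_of_eq ?_) this
    simp only [hg]
    rw [Real.log_div (by positivity) (by positivity), Real.log_mul (by positivity) (by positivity),
      Real.log_mul (by positivity) (by positivity)]
    ring
  refine (Finset.sum_le_sum fun i _ => h1 i).trans ?_
  rw [Finset.sum_sub_distrib, sum_cnt s g, Fintype.sum_prod_type_right]
  have h2 : ∑ b, ∑ a, cnt s (a, b) * g (a, b) ≤ ∑ b, cnt (fun i => (s i).2) b * 1 := by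
    refine Finset.sum_le_sum fun b _ => ?_
    have h3 : ∀ a, cnt s (a, b) * g (a, b) ≤
        cnt (fun i => (s i).2) b * (p (a, b) / ∑ a, p (a, b)) := by
      intro a
      have c1 := cnt_nonneg (fun i => (s i).2) b
      have c2 : 0 ≤ p (a, b) / ∑ a, p (a, b) := div_nonneg (hp _) (Finset.sum_nonneg fun _ _ => hp _)
      by_cases h : cnt s (a, b) = 0
      · rw [h, zero_mul]
        positivity
      · simp only [hg]
        apply le_of_eq
        by_cases h' : ∑ a, p (a, b) = 0
        · simp [h']
        · field_simp
    refine (Finset.sum_le_sum fun a _ => h3 a).trans ?_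
    rw [← Finset.mul_sum, ← Finset.sum_div]
    exact mul_le_mul_of_nonneg_left (div_self_le_one _) (cnt_nonneg _ _)
  rw [← sum_cnt (fun i => (s i).2) (fun _ => 1)] at h2
  linarith

lemma card_supp_le {α β : Type*} [Fintype α] [Fintype β] [DecidableEq α] [DecidableEq β]
    (p : α × β → ℝ) (hp : ∀ x, 0 ≤ p x) (b : β) :
    (∑ a, if p (a, b) ≠ 0 then (1 : ℝ) else 0) ≤ suppA p := by
  classical
  unfold suppA
  rw [Finset.sum_boole]
  norm_cast
  apply Finset.card_le_card
  intro a
  simp only [Finset.mem_filter, Finset.mem_univ, true_and]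
  intro h h0
  rw [Finset.sum_eq_zero_iff_of_nonneg (fun _ _ => hp _)] at h0
  exact h (h0 b (Finset.mem_univ _))

/-- resampling the first component of one coordinate -/
lemma resample {α β : Type*} [Fintype α] [Fintype β] [DecidableEq α] [DecidableEq β]
    (p : α × β → ℝ) {N : ℕ} (i : Fin N) (G : (Fin N → α × β) → ℝ) :
    ∑ s : Fin N → α × β, iidW p s * (G s * (∑ a, p (a, (s i).2)) / p (s i)) =
    ∑ s : Fin N → α × β, iidW p s * ∑ a, if p (a, (s i).2) ≠ 0 then
      G (Function.update s i (a, (s i).2)) else 0 := by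
  have hW : ∀ (s : Fin N → α × β) x, iidW p (Function.update s i x)
      = p x * ∏ k ∈ Finset.univ \ {i}, p (s k) := by
    intro s x
    unfold iidW
    rw [← Finset.mul_prod_erase _ _ (Finset.mem_univ i), Finset.sdiff_singleton_eq_erase]
    simp only [Function.update_self]
    congr 1
    refine Finset.prod_congr rfl fun k hk => ?_
    rw [Function.update_of_ne (Finset.ne_of_mem_erase hk)]
  have hW' : ∀ (s : Fin N → α × β), iidW p s
      = p (s i) * ∏ k ∈ Finset.univ \ {i}, p (s k) := by
    intro s
    have := hW s (s i)
    rwa [Function.update_eq_self] at this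
  have hL : ∀ s : Fin N → α × β, iidW p s * (G s * (∑ a, p (a, (s i).2)) / p (s i))
      = ∑ a, if p (s i) ≠ 0 then iidW p (Function.update s i (a, (s i).2)) * G s else 0 := by
    intro s
    by_cases h : p (s i) = 0
    · simp [h]
    · simp only [ne_eq, h, not_false_eq_true, if_true, hW]
      rw [← Finset.sum_mul, ← Finset.sum_mul, hW' s]
      field_simp
  rw [Finset.sum_congr rfl fun s _ => hL s]
  simp only [Finset.mul_sum]
  rw [← Fintype.sum_prod_type', ← Fintype.sum_prod_type']
  let e : (Fin N → α × β) × α → (Fin N → α × β) × α :=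
    fun q => (Function.update q.1 i (q.2, (q.1 i).2), (q.1 i).1)
  have he : Function.Involutive e := by
    intro q
    simp [e]
  refine Fintype.sum_equiv he.toPerm _ _ ?_
  intro q
  simp [e]

lemma cnt_upd {α β : Type*} [Fintype α] [Fintype β] [DecidableEq α] [DecidableEq β]
    (p : α × β → ℝ) (hp : ∀ x, 0 ≤ p x) {N : ℕ} (i : Fin N) (s : Fin N → α × β) :
    (∑ a, if p (a, (s i).2) ≠ 0 then cnt (Function.update s i (a, (s i).2)) (a, (s i).2) else 0)
      ≤ suppA p + (cnt (fun k => (s k).2) (s i).2 - 1) := by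
  have h1 : ∀ a, cnt (Function.update s i (a, (s i).2)) (a, (s i).2)
      = 1 + (cnt s (a, (s i).2) - if s i = (a, (s i).2) then 1 else 0) := by
    intro a
    rw [cnt_eq_sum, cnt_eq_sum, ← Finset.add_sum_erase _ _ (Finset.mem_univ i),
      ← Finset.add_sum_erase (a := i) _ (fun k => if s k = (a, (s i).2) then (1 : ℝ) else 0)
        (Finset.mem_univ i)]
    simp only [Function.update_self, if_true, add_sub_cancel_left]
    congr 1
    refine Finset.sum_congr rfl fun k hk => ?_
    rw [Function.update_of_ne (Finset.ne_of_mem_erase hk)]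
  have h2 : ∀ a, 0 ≤ cnt s (a, (s i).2) - if s i = (a, (s i).2) then 1 else 0 := by
    intro a
    split_ifs with h
    · have := cnt_pos s i
      rw [← h]
      unfold cnt at *
      have : 1 ≤ (Finset.univ.filter (fun k => s k = s i)).card := by exact_mod_cast this
      have : (1 : ℝ) ≤ ((Finset.univ.filter (fun k => s k = s i)).card : ℝ) := by exact_mod_cast this
      linarith
    · simpa using cnt_nonneg _ _
  have h3 : ∀ a, (if p (a, (s i).2) ≠ 0 then
      cnt (Function.update s i (a, (s i).2)) (a, (s i).2) else 0) ≤
      (if p (a, (s i).2) ≠ 0 then (1 : ℝ) else 0) +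
        (cnt s (a, (s i).2) - if s i = (a, (s i).2) then 1 else 0) := by
    intro a
    have := h2 a
    rw [h1]
    by_cases hh : p (a, (s i).2) = 0
    · simpa [hh] using this
    · simp [hh]
  refine (Finset.sum_le_sum fun a _ => h3 a).trans ?_
  rw [Finset.sum_add_distrib, Finset.sum_sub_distrib, sum_cnt_fst]
  have h4 : (∑ a, if s i = (a, (s i).2) then (1 : ℝ) else 0) = 1 := by
    simp [Prod.ext_iff]
  rw [h4]
  have := card_supp_le p hp (s i).2
  linarith

lemma sum_inv_le {α β : Type*} [Fintype α] [Fintype β] [DecidableEq α] [DecidableEq β]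
    (p : α × β → ℝ) (hp : ∀ x, 0 ≤ p x) {N : ℕ} (s : Fin N → α × β) (hs : iidW p s ≠ 0) :
    ∑ i, (cnt (fun k => (s k).2) (s i).2)⁻¹ ≤ suppB p := by
  classical
  rw [sum_cnt (fun k => (s k).2) (fun b => (cnt (fun k => (s k).2) b)⁻¹)]
  unfold suppB
  rw [← Finset.sum_boole]
  refine Finset.sum_le_sum fun b _ => ?_
  split_ifs with h
  · exact mul_inv_le_one
  · have : cnt (fun k => (s k).2) b = 0 := by
      by_contra hc
      obtain ⟨i, rfl⟩ := exists_of_cnt_ne _ _ hc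
      exact h ((pos_of_W p hp s hs i).trans_le (marg_ge p hp (s i))).ne'
    simp [this]

lemma expect_R {α β : Type*} [Fintype α] [Fintype β] [DecidableEq α] [DecidableEq β]
    (p : α × β → ℝ) (hp : ∀ x, 0 ≤ p x) {N : ℕ} (i : Fin N) :
    ∑ s : Fin N → α × β, iidW p s *
      (cnt s (s i) / cnt (fun k => (s k).2) (s i).2 * (∑ a, p (a, (s i).2)) / p (s i)) ≤
    ∑ s : Fin N → α × β, iidW p s *
      (1 + ((suppA p : ℝ) - 1) * (cnt (fun k => (s k).2) (s i).2)⁻¹) := by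
  rw [resample p i (fun s => cnt s (s i) / cnt (fun k => (s k).2) (s i).2)]
  refine Finset.sum_le_sum fun s _ => mul_le_mul_of_nonneg_left ?_ (iidW_nonneg p hp s)
  have h0 := cnt_pos (fun k => (s k).2) i
  have h1 : ∀ a, (fun k => (Function.update s i (a, (s i).2) k).2) = fun k => (s k).2 := by
    intro a
    funext k
    by_cases hk : k = i
    · subst hk; simp
    · rw [Function.update_of_ne hk]
  simp only [h1, Function.update_self]
  have h2 := cnt_upd p hp i s
  have h3 : (∑ a, if p (a, (s i).2) ≠ 0 then
      cnt (Function.update s i (a, (s i).2)) (a, (s i).2) / cnt (fun k => (s k).2) (s i).2 else 0)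
      = (∑ a, if p (a, (s i).2) ≠ 0 then
      cnt (Function.update s i (a, (s i).2)) (a, (s i).2) else 0)
        / cnt (fun k => (s k).2) (s i).2 := by
    rw [Finset.sum_div]
    refine Finset.sum_congr rfl fun a _ => ?_
    split_ifs <;> simp
  rw [h3, div_le_iff₀ h0]
  refine h2.trans (le_of_eq ?_)
  field_simp
  ring

lemma one_le_suppA {α β : Type*} [Fintype α] [Fintype β]
    (p : α × β → ℝ) (hp1 : ∑ x : α × β, p x = 1) : (1 : ℝ) ≤ suppA p := by
  classical
  have : 0 < suppA p := by
    unfold suppA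
    rw [Finset.card_pos]
    by_contra hc
    rw [Finset.not_nonempty_iff_eq_empty, Finset.filter_eq_empty_iff] at hc
    rw [Fintype.sum_prod_type] at hp1
    rw [Finset.sum_eq_zero] at hp1
    · norm_num at hp1
    · intro a _
      simpa using hc (Finset.mem_univ a)
  exact_mod_cast this

theorem plugin_conditional_entropy_bias
    {α β : Type*} [Fintype α] [Fintype β] [DecidableEq α] [DecidableEq β]
    (p : α × β → ℝ) (hp : ∀ x, 0 ≤ p x) (hp1 : ∑ x : α × β, p x = 1)
    (N : ℕ) (hN : 0 < N) :
    -(((suppA p : ℝ) - 1) * (suppB p : ℝ) / N) ≤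
        (∑ s : Fin N → α × β, iidW p s * plugInEst s) - condEntPMF p ∧
      (∑ s : Fin N → α × β, iidW p s * plugInEst s) - condEntPMF p ≤ 0 := by
  have hNr : (0 : ℝ) < N := by exact_mod_cast hN
  rw [bias_eq p hp1 N hN]
  constructor
  · have hsum1 : ∑ s : Fin N → α × β, iidW p s = 1 := by
      have := sum_iidW p hp1 (⟨0, hN⟩ : Fin N) (fun _ => 1)
      simpa [hp1] using this
    -- the ratio
    set R : (Fin N → α × β) → Fin N → ℝ := fun s i =>
      cnt s (s i) / cnt (fun k => (s k).2) (s i).2 * (∑ a, p (a, (s i).2)) / p (s i) with hR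
    have hlow : ∀ s : Fin N → α × β, iidW p s * ((∑ i, (1 - R s i)) / N) ≤
        iidW p s * ((∑ i, (Real.log (cnt (fun i => (s i).2) (s i).2)
      - Real.log (cnt s (s i)) - (Real.log (∑ a, p (a, (s i).2)) - Real.log (p (s i))))) / N) := by
      intro s
      by_cases hs : iidW p s = 0
      · simp [hs]
      refine mul_le_mul_of_nonneg_left ?_ (iidW_nonneg p hp s)
      refine div_le_div_of_nonneg_right ?_ hNr.le
      refine Finset.sum_le_sum fun i _ => ?_
      have a1 := cnt_pos s i
      have a2 := cnt_pos (fun i => (s i).2) i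
      have a3 := pos_of_W p hp s hs i
      have a4 := a3.trans_le (marg_ge p hp (s i))
      have := Real.log_le_sub_one_of_pos (x := R s i) (by simp only [hR]; positivity)
      have h2 : Real.log (R s i) = -(Real.log (cnt (fun i => (s i).2) (s i).2)
        - Real.log (cnt s (s i)) - (Real.log (∑ a, p (a, (s i).2)) - Real.log (p (s i)))) := by
        simp only [hR]
        rw [Real.log_div (by positivity) (by positivity),
          Real.log_mul (by positivity) (by positivity),
          Real.log_div (by positivity) (by positivity)]
        ring
      linarith
    refine le_trans ?_ (Finset.sum_le_sum fun s _ => hlow s)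
    have e1 : ∑ s : Fin N → α × β, iidW p s * ((∑ i, (1 - R s i)) / N)
        = (N - ∑ i, ∑ s : Fin N → α × β, iidW p s * R s i) / N := by
      rw [Finset.sum_comm]
      simp only [← Finset.mul_sum, ← mul_div_assoc]
      rw [← Finset.sum_div]
      congr 1
      simp only [Finset.sum_sub_distrib, mul_sub]
      rw [← Finset.sum_mul, hsum1]
      simp
    rw [e1, ← neg_div]
    refine div_le_div_of_nonneg_right ?_ hNr.le
    have e2 : ∑ i, ∑ s : Fin N → α × β, iidW p s * R s i ≤
        ∑ s : Fin N → α × β, iidW p s * (N + ((suppA p : ℝ) - 1) * suppB p) := by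
      refine (Finset.sum_le_sum fun i _ => expect_R p hp i).trans ?_
      rw [Finset.sum_comm]
      refine Finset.sum_le_sum fun s _ => ?_
      by_cases hs : iidW p s = 0
      · simp [hs]
      rw [← Finset.mul_sum]
      refine mul_le_mul_of_nonneg_left ?_ (iidW_nonneg p hp s)
      rw [Finset.sum_add_distrib, ← Finset.mul_sum]
      have h1 := mul_le_mul_of_nonneg_left (sum_inv_le p hp s hs)
        (sub_nonneg.mpr (one_le_suppA p hp1))
      simpa using h1
    rw [← Finset.sum_mul, hsum1] at e2
    linarith
  · refine Finset.sum_nonpos fun s _ => ?_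
    by_cases hs : iidW p s = 0
    · simp [hs]
    exact mul_nonpos_of_nonneg_of_nonpos (iidW_nonneg p hp s)
      (div_nonpos_of_nonpos_of_nonneg (upper p hp s hs) hNr.le)
end

section
/- Let A and B be discrete random variables, where A has support cardinality M_a, and let Ĥ(A∣B) be the plug-in estimator of H(A∣B) based on N i.i.d. copies of (A,B), where N ≥ max(M_a, 2). Then for every ε > 0, P(|Ĥ(A∣B) − E[Ĥ(A∣B)]| > ε) ≤ 2·exp(−N·ε² / (2·log²(N))). -/
open Finset

namespace PlugInAux

/-- The function `k log k` on naturals. -/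
noncomputable def G (k : ℕ) : ℝ := (k : ℝ) * Real.log k

lemma G_mono_step (k : ℕ) : 0 ≤ G (k + 1) - G k := by
  unfold G
  rcases Nat.eq_zero_or_pos k with rfl | hk
  · simp
  · have hk' : (1 : ℝ) ≤ k := by exact_mod_cast hk
    have h1 : Real.log k ≤ Real.log ((k + 1 : ℕ) : ℝ) :=
      Real.log_le_log (by linarith) (by push_cast; linarith)
    have h0 : 0 ≤ Real.log k := Real.log_nonneg hk'
    push_cast at *
    nlinarith

lemma G_conv_step (k : ℕ) : G (k + 1) - G k ≤ G (k + 2) - G (k + 1) := by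
  have hk : (k : ℝ) ∈ Set.Ici (0 : ℝ) := by simp
  have hk2 : (k : ℝ) + 2 ∈ Set.Ici (0 : ℝ) := by
    have : (0 : ℝ) ≤ k + 2 := by positivity
    simpa using this
  have h := Real.convexOn_mul_log.2 hk hk2
    (show (0 : ℝ) ≤ 1 / 2 by norm_num) (show (0 : ℝ) ≤ 1 / 2 by norm_num) (by norm_num)
  simp only [smul_eq_mul] at h
  have e : (1 / 2 : ℝ) * (k : ℝ) + 1 / 2 * ((k : ℝ) + 2) = k + 1 := by ring
  rw [e] at h
  unfold G
  push_cast
  linarith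

lemma G_conv {j k : ℕ} (h : j ≤ k) : G (j + 1) - G j ≤ G (k + 1) - G k := by
  have : Monotone (fun k => G (k + 1) - G k) := monotone_nat_of_le_succ G_conv_step
  exact this h

lemma G_step_le (k : ℕ) : G (k + 1) - G k ≤ 2 * Real.log ((k : ℝ) + 1) := by
  rcases Nat.eq_zero_or_pos k with rfl | hk
  · simp [G]
  · have hk' : (1 : ℝ) ≤ k := by exact_mod_cast hk
    have hk0 : (0 : ℝ) < k := by linarith
    have h := strictConcaveOn_log_Ioi.concaveOn.2
      (show (k : ℝ) + 1 ∈ Set.Ioi (0 : ℝ) from by simp only [Set.mem_Ioi]; positivity)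
      (show (1 : ℝ) ∈ Set.Ioi (0 : ℝ) from by simp)
      (show 0 ≤ ((k : ℝ) - 1) / k by apply div_nonneg <;> linarith)
      (show 0 ≤ 1 / (k : ℝ) by positivity)
      (by field_simp; ring)
    simp only [smul_eq_mul, Real.log_one, mul_zero, add_zero] at h
    have e : ((k : ℝ) - 1) / k * (k + 1) + 1 / k * 1 = k := by field_simp; ring
    rw [e, div_mul_eq_mul_div, div_le_iff₀ hk0] at h
    unfold G
    push_cast
    linarith

section
variable {α β : Type*} [Fintype α] [Fintype β] [DecidableEq α] [DecidableEq β]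

/-- Unnormalised conditional entropy of counts. -/
noncomputable def Phi (c : α × β → ℕ) : ℝ :=
  ∑ b : β, G (∑ a : α, c (a, b)) - ∑ x : α × β, G (c x)

lemma negMulLog_div (k N : ℕ) (hN : 0 < N) :
    Real.negMulLog ((k : ℝ) / N) = (k : ℝ) / N * Real.log N - G k / N := by
  unfold G Real.negMulLog
  rcases Nat.eq_zero_or_pos k with rfl | hk
  · simp
  · rw [Real.log_div (by positivity) (by positivity)]
    field_simp
    ring

/-- Counts of a sample. -/
def cnt {N : ℕ} (s : Fin N → α × β) (x : α × β) : ℕ := (univ.filter (fun i => s i = x)).card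

lemma plugIn_eq {N : ℕ} (hN : 0 < N) (s : Fin N → α × β) :
    plugInEst s = Phi (cnt s) / N := by
  unfold plugInEst condEntPMF entPMF
  have e1 : ∀ x, empDist s x = (cnt s x : ℝ) / N := fun x => rfl
  have e2 : ∀ b, ∑ a, empDist s (a, b) = ((∑ a, cnt s (a, b) : ℕ) : ℝ) / N := by
    intro b
    simp only [e1]
    rw [← Finset.sum_div]
    push_cast
    rfl
  simp only [e2]
  simp only [e1, negMulLog_div _ N hN, Finset.sum_sub_distrib, ← Finset.sum_mul,
    ← Finset.sum_div]
  have e3 : ∑ x, (cnt s x : ℝ) = ∑ b, ((∑ a, cnt s (a, b) : ℕ) : ℝ) := by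
    rw [Fintype.sum_prod_type_right]
    push_cast
    rfl
  rw [e3]
  unfold Phi
  ring

lemma Phi_add (c : α × β → ℕ) (x : α × β) (c' : α × β → ℕ)
    (hc' : ∀ y, c' y = c y + if x = y then 1 else 0) :
    Phi c' - Phi c = (G (∑ a, c (a, x.2) + 1) - G (∑ a, c (a, x.2))) - (G (c x + 1) - G (c x)) := by
  have h1 : ∀ b, G (∑ a, c' (a, b)) = G (∑ a, c (a, b)) +
      if x.2 = b then (G (∑ a, c (a, x.2) + 1) - G (∑ a, c (a, x.2))) else 0 := by
    intro b
    have : ∑ a, c' (a, b) = ∑ a, c (a, b) + if x.2 = b then 1 else 0 := by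
      simp only [hc', Finset.sum_add_distrib]
      congr 1
      obtain ⟨u, v⟩ := x
      by_cases h : v = b
      · subst h; simp
      · simp [h]
    rw [this]
    by_cases h : x.2 = b
    · subst h; simp
    · simp [h]
  have h2 : ∀ y, G (c' y) = G (c y) + if x = y then G (c x + 1) - G (c x) else 0 := by
    intro y
    rw [hc']
    by_cases h : x = y
    · subst h; simp
    · simp [h]
  unfold Phi
  simp only [h1, h2, Finset.sum_add_distrib, Finset.sum_ite_eq, Finset.mem_univ, if_true]
  ring

lemma Phi_add_bounds (c : α × β → ℕ) (x : α × β) (c' : α × β → ℕ)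
    (hc' : ∀ y, c' y = c y + if x = y then 1 else 0) (N : ℕ) (hN : ∑ y, c y + 1 ≤ N) :
    0 ≤ Phi c' - Phi c ∧ Phi c' - Phi c ≤ 2 * Real.log N := by
  rw [Phi_add c x c' hc']
  have hle : c x ≤ ∑ a, c (a, x.2) :=
    Finset.single_le_sum (f := fun a => c (a, x.2)) (fun _ _ => Nat.zero_le _)
      (Finset.mem_univ x.1)
  have hle2 : ∑ a, c (a, x.2) ≤ ∑ y, c y := by
    rw [Fintype.sum_prod_type_right]
    exact Finset.single_le_sum (f := fun b => ∑ a, c (a, b)) (fun _ _ => Nat.zero_le _)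
      (Finset.mem_univ x.2)
  refine ⟨by linarith [G_conv hle], ?_⟩
  have h1 := G_step_le (∑ a, c (a, x.2))
  have h2 := G_mono_step (c x)
  have h3 : Real.log (((∑ a, c (a, x.2) : ℕ) : ℝ) + 1) ≤ Real.log N := by
    apply Real.log_le_log (by positivity)
    exact_mod_cast (by omega : ∑ a, c (a, x.2) + 1 ≤ N)
  linarith

/-- Counts with the `i`-th sample removed. -/
def cntE {N : ℕ} (i : Fin N) (s : Fin N → α × β) (x : α × β) : ℕ :=
  ∑ j ∈ univ.erase i, if s j = x then 1 else 0

lemma cnt_eq {N : ℕ} (i : Fin N) (s : Fin N → α × β) (y : α × β) :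
    cnt s y = cntE i s y + if s i = y then 1 else 0 := by
  unfold cnt cntE
  rw [Finset.card_filter, Finset.sum_erase_add _ _ (Finset.mem_univ i)]

lemma cntE_sum {N : ℕ} (i : Fin N) (s : Fin N → α × β) : ∑ y, cntE i s y + 1 ≤ N := by
  unfold cntE
  rw [Finset.sum_comm]
  simp
  have := i.pos
  omega

lemma cntE_update {N : ℕ} (i : Fin N) (s : Fin N → α × β) (z : α × β) :
    cntE i (Function.update s i z) = cntE i s := by
  funext y
  unfold cntE
  apply Finset.sum_congr rfl
  intro j hj
  rw [Function.update_of_ne (Finset.ne_of_mem_erase hj)]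

lemma bdd_diff {N : ℕ} (i : Fin N) (s : Fin N → α × β) (z : α × β) :
    |plugInEst (Function.update s i z) - plugInEst s| ≤ 2 * Real.log N / N := by
  have hN : 0 < N := i.pos
  have hN' : (0 : ℝ) < N := by exact_mod_cast hN
  rw [plugIn_eq hN, plugIn_eq hN, ← sub_div, abs_div, abs_of_pos hN']
  gcongr
  obtain ⟨a1, a2⟩ := Phi_add_bounds (cntE i s) (s i) (cnt s) (cnt_eq i s) N (cntE_sum i s)
  obtain ⟨b1, b2⟩ := Phi_add_bounds (cntE i s) z (cnt (Function.update s i z))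
    (fun y => by rw [cnt_eq i, cntE_update]; simp) N (cntE_sum i s)
  rw [abs_le]
  constructor <;> linarith
end

section
variable {X : Type*} [Fintype X]

open MeasureTheory ProbabilityTheory in
lemma hoeffding (p : X → ℝ) (hp : ∀ x, 0 ≤ p x) (hp1 : ∑ x, p x = 1) (h : X → ℝ) (c : ℝ)
    (hc : ∀ x y, |h x - h y| ≤ c) (t : ℝ) :
    ∑ x, p x * Real.exp (t * (h x - ∑ y, p y * h y)) ≤ Real.exp (t ^ 2 * c ^ 2 / 8) := by
  classical
  have hne : Nonempty X := by
    by_contra hX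
    rw [not_nonempty_iff] at hX
    simp at hp1
  let _ : MeasurableSpace X := ⊤
  have : MeasurableSingletonClass X := ⟨fun _ => trivial⟩
  let P : PMF X := PMF.ofFintype (fun x => ENNReal.ofReal (p x)) (by
    rw [← ENNReal.ofReal_sum_of_nonneg (fun x _ => hp x), hp1, ENNReal.ofReal_one])
  have hint : ∀ f : X → ℝ, ∫ a, f a ∂P.toMeasure = ∑ a, p a * f a := by
    intro f
    rw [PMF.integral_eq_sum]
    apply Finset.sum_congr rfl
    intro x _
    simp [P, ENNReal.toReal_ofReal (hp x)]
  obtain ⟨x0, hx0⟩ := Finite.exists_min h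
  have hc0 : 0 ≤ c := le_trans (abs_nonneg _) (hc x0 x0)
  have key := hasSubgaussianMGF_of_mem_Icc (μ := P.toMeasure) (X := h) (a := h x0) (b := h x0 + c)
    (measurable_from_top.aemeasurable)
    (Filter.Eventually.of_forall (fun x => ⟨hx0 x, by
      have := (abs_le.1 (hc x x0)).2
      linarith⟩))
  have := key.mgf_le t
  rw [mgf, hint, hint] at this
  refine this.trans_eq ?_
  congr 1
  simp [div_pow]
  ring

lemma sum_cons {n : ℕ} (F : (Fin (n + 1) → X) → ℝ) :
    ∑ s, F s = ∑ x : X, ∑ s : Fin n → X, F (Fin.cons x s) := by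
  rw [← (Fin.consEquiv (fun _ => X)).sum_comp, Fintype.sum_prod_type]
  rfl

lemma sum_prod_one (p : X → ℝ) (hp1 : ∑ x, p x = 1) (n : ℕ) :
    ∑ s : Fin n → X, ∏ i, p (s i) = 1 := by
  classical
  have := Fintype.sum_pow p n
  rw [← this, hp1, one_pow]

lemma mgf_bound (p : X → ℝ) (hp : ∀ x, 0 ≤ p x) (hp1 : ∑ x, p x = 1) (c t : ℝ) (n : ℕ) :
    ∀ (f : (Fin n → X) → ℝ), (∀ i s z, |f (Function.update s i z) - f s| ≤ c) →
    ∑ s : Fin n → X, (∏ i, p (s i)) * Real.exp (t * (f s - ∑ s', (∏ i, p (s' i)) * f s')) ≤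
      Real.exp (n * (t ^ 2 * c ^ 2 / 8)) := by
  induction n with
  | zero => intro f _; simp
  | succ n ih =>
    intro f hf
    set h : X → ℝ := fun x => ∑ s : Fin n → X, (∏ i, p (s i)) * f (Fin.cons x s) with hh
    have hE : ∑ s' : Fin (n + 1) → X, (∏ i, p (s' i)) * f s' = ∑ x, p x * h x := by
      rw [sum_cons]
      apply Finset.sum_congr rfl
      intro x _
      rw [hh, Finset.mul_sum]
      apply Finset.sum_congr rfl
      intro s _
      rw [Fin.prod_univ_succ]
      simp [mul_assoc]
    rw [hE, sum_cons]
    have hdiff : ∀ x y, |h x - h y| ≤ c := by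
      intro x y
      rw [hh]
      simp only
      rw [← Finset.sum_sub_distrib]
      calc |∑ s : Fin n → X, ((∏ i, p (s i)) * f (Fin.cons x s) - (∏ i, p (s i)) * f (Fin.cons y s))|
          ≤ ∑ s : Fin n → X, |(∏ i, p (s i)) * f (Fin.cons x s) - (∏ i, p (s i)) * f (Fin.cons y s)| :=
            Finset.abs_sum_le_sum_abs _ _
        _ ≤ ∑ s : Fin n → X, (∏ i, p (s i)) * c := by
            apply Finset.sum_le_sum
            intro s _
            have h0 : 0 ≤ ∏ i, p (s i) := Finset.prod_nonneg (fun i _ => hp _)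
            rw [← mul_sub, abs_mul, abs_of_nonneg h0]
            apply mul_le_mul_of_nonneg_left _ h0
            have := hf 0 (Fin.cons y s) x
            rwa [Fin.update_cons_zero] at this
        _ = c := by rw [← Finset.sum_mul, sum_prod_one p hp1, one_mul]
    set E := ∑ x, p x * h x with hEdef
    calc ∑ x : X, ∑ s : Fin n → X, (∏ i, p ((Fin.cons x s : Fin (n + 1) → X) i)) *
            Real.exp (t * (f (Fin.cons x s) - E))
        = ∑ x : X, p x * Real.exp (t * (h x - E)) * ∑ s : Fin n → X, (∏ i, p (s i)) *
            Real.exp (t * (f (Fin.cons x s) - h x)) := by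
          apply Finset.sum_congr rfl
          intro x _
          rw [Finset.mul_sum]
          apply Finset.sum_congr rfl
          intro s _
          rw [Fin.prod_univ_succ]
          have : t * (f (Fin.cons x s) - E) = t * (h x - E) + t * (f (Fin.cons x s) - h x) := by
            ring
          rw [this, Real.exp_add]
          simp only [Fin.cons_zero, Fin.cons_succ]
          ring
      _ ≤ ∑ x : X, p x * Real.exp (t * (h x - E)) * Real.exp (n * (t ^ 2 * c ^ 2 / 8)) := by
          apply Finset.sum_le_sum
          intro x _
          apply mul_le_mul_of_nonneg_left _ (mul_nonneg (hp x) (Real.exp_nonneg _))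
          apply ih (fun s => f (Fin.cons x s))
          intro i s z
          have := hf i.succ (Fin.cons x s) z
          rwa [← Fin.cons_update] at this
      _ ≤ Real.exp (t ^ 2 * c ^ 2 / 8) * Real.exp (n * (t ^ 2 * c ^ 2 / 8)) := by
          rw [← Finset.sum_mul]
          exact mul_le_mul_of_nonneg_right (hoeffding p hp hp1 h c hdiff t) (Real.exp_nonneg _)
      _ = Real.exp ((n + 1 : ℕ) * (t ^ 2 * c ^ 2 / 8)) := by
          rw [← Real.exp_add]
          push_cast
          ring_nf
end

end PlugInAux

theorem plugin_conditional_entropy_mcdiarmid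
    {α β : Type*} [Fintype α] [Fintype β] [DecidableEq α] [DecidableEq β]
    (p : α × β → ℝ) (hp : ∀ x, 0 ≤ p x) (hp1 : ∑ x : α × β, p x = 1)
    (N : ℕ) (hNa : suppA p ≤ N) (hN2 : 2 ≤ N) (ε : ℝ) (hε : 0 < ε) :
    prIID p (fun s : Fin N → α × β =>
        ε < |plugInEst s - ∑ s' : Fin N → α × β, iidW p s' * plugInEst s'|) ≤
      2 * Real.exp (-((N : ℝ) * ε ^ 2) / (2 * (Real.log N) ^ 2)) := by
  have hN2' : (2 : ℝ) ≤ N := by exact_mod_cast hN2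
  have hN0 : (0 : ℝ) < N := by linarith
  have hL : 0 < Real.log N := Real.log_pos (by linarith)
  set L := Real.log N with hLdef
  set t : ℝ := ε * N / L ^ 2 with ht
  have ht0 : 0 < t := by positivity
  have m1 := PlugInAux.mgf_bound p hp hp1 (2 * L / N) t N plugInEst PlugInAux.bdd_diff
  have m2 := PlugInAux.mgf_bound p hp hp1 (2 * L / N) (-t) N plugInEst PlugInAux.bdd_diff
  unfold prIID
  unfold iidW
  set E := ∑ s' : Fin N → α × β, (∏ i, p (s' i)) * plugInEst s' with hE
  have hexp : Real.exp (-(t * ε)) * Real.exp (N * (t ^ 2 * (2 * L / N) ^ 2 / 8)) =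
      Real.exp (-((N : ℝ) * ε ^ 2) / (2 * L ^ 2)) := by
    rw [← Real.exp_add, ht]
    congr 1
    field_simp
    ring
  rw [neg_sq] at m2
  calc _ ≤ ∑ s : Fin N → α × β, Real.exp (-(t * ε)) *
        ((∏ i, p (s i)) * Real.exp (t * (plugInEst s - E)) +
         (∏ i, p (s i)) * Real.exp (-t * (plugInEst s - E))) := by
        apply Finset.sum_le_sum
        intro s _
        have h0 : 0 ≤ ∏ i, p (s i) := Finset.prod_nonneg (fun i _ => hp _)
        split_ifs with h
        · rw [← mul_add, mul_left_comm, mul_add, ← Real.exp_add, ← Real.exp_add]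
          apply le_mul_of_one_le_right h0
          rcases lt_abs.1 h with h | h
          · have : 1 ≤ Real.exp (-(t * ε) + t * (plugInEst s - E)) :=
              Real.one_le_exp (by nlinarith)
            linarith [Real.exp_nonneg (-(t * ε) + -t * (plugInEst s - E))]
          · have : 1 ≤ Real.exp (-(t * ε) + -t * (plugInEst s - E)) :=
              Real.one_le_exp (by nlinarith)
            linarith [Real.exp_nonneg (-(t * ε) + t * (plugInEst s - E))]
        · positivity
    _ ≤ _ := by
        rw [← Finset.mul_sum, Finset.sum_add_distrib, ← hexp]
        have := Real.exp_nonneg (-(t * ε))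
        nlinarith
end

section
/- Let α ≥ 1 be a real number and let N ≥ e² be a real number. If N ≥ α·log²(α), then N / log²(N) ≥ α/4. -/
theorem div_log_sq_ge_quarter (α N : ℝ) (hα : 1 ≤ α) (hN : Real.exp 2 ≤ N)
    (h : α * (Real.log α) ^ 2 ≤ N) :
    α / 4 ≤ N / (Real.log N) ^ 2 := by
  have hN0 : 0 < N := lt_of_lt_of_le (Real.exp_pos 2) hN
  have hL : 2 ≤ Real.log N := (Real.le_log_iff_exp_le hN0).2 hN
  have hα0 : 0 < α := by linarith
  have key : α * (Real.log N) ^ 2 ≤ 4 * N := by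
    by_cases hc : N ≤ α ^ 2
    · have h1 : Real.log N ≤ 2 * Real.log α := by
        have := Real.log_le_log hN0 hc
        rw [Real.log_pow] at this
        exact_mod_cast this
      have h2 : (Real.log N) ^ 2 ≤ (2 * Real.log α) ^ 2 :=
        pow_le_pow_left₀ (by linarith) h1 2
      have h3 := mul_le_mul_of_nonneg_left h2 hα0.le
      nlinarith
    · push Not at hc
      obtain ⟨t, ht⟩ : ∃ t, t = Real.log N / 4 := ⟨_, rfl⟩
      have hLt : Real.log N = 4 * t := by linarith
      have ht0 : 0 ≤ t := by linarith
      have hy : 2 * t ≤ Real.exp t := by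
        have := Real.quadratic_le_exp_of_nonneg ht0
        nlinarith [sq_nonneg (t - 1)]
      have hNy : N = (Real.exp t) ^ 4 := by
        rw [← Real.exp_nat_mul, ← Real.exp_log hN0, hLt]
        norm_num
      have hy0 := Real.exp_pos t
      generalize Real.exp t = y at *
      have hαy : α ≤ y ^ 2 := by
        apply le_of_lt
        apply lt_of_pow_lt_pow_left₀ 2 (by positivity)
        calc α ^ 2 < N := hc
          _ = (y ^ 2) ^ 2 := by rw [hNy]; ring
      have h4 : (2 * t) ^ 2 ≤ y ^ 2 := pow_le_pow_left₀ (by linarith) hy 2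
      have h5 : α * (2 * t) ^ 2 ≤ y ^ 2 * y ^ 2 :=
        mul_le_mul hαy h4 (by positivity) (by positivity)
      rw [hLt, hNy]
      nlinarith
  rw [div_le_div_iff₀ (by norm_num) (by positivity)]
  linarith
end

section
/- Let X_a, X_b, Y and a finite tuple of discrete random variables Π be given, all with finite supports, and let λ > 0. Assume H(X_b ∣ X_a, Y, Π) = H(X_b ∣ X_a) (i.e., X_b is conditionally independent of (Y, Π) given X_a) and max(H(X_b ∣ X_a), H(X_a ∣ X_b)) ≤ λ. Then |H(Y ∣ Π, X_b) − H(Y ∣ Π, X_a)| ≤ 3λ. -/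
open Finset

/-- Shannon entropy (in nats) of a discrete random variable `X` on a finite
probability space with probability mass function `μ`. -/
noncomputable def ent {Ω γ : Type*} [Fintype Ω] [Fintype γ] [DecidableEq γ]
    (μ : Ω → ℝ) (X : Ω → γ) : ℝ :=
  ∑ x : γ, Real.negMulLog (∑ ω : Ω, if X ω = x then μ ω else 0)

/-- Conditional Shannon entropy H(X ∣ Y), via the chain rule `H(X ∣ Y) = H(X,Y) - H(Y)`. -/
noncomputable def condEnt {Ω γ δ : Type*} [Fintype Ω] [Fintype γ] [Fintype δ]
    [DecidableEq γ] [DecidableEq δ] (μ : Ω → ℝ) (X : Ω → γ) (Y : Ω → δ) : ℝ :=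
  ent μ (fun ω => (X ω, Y ω)) - ent μ Y

/-- `μ` is a probability mass function on the finite sample space `Ω`. -/
def IsPMF {Ω : Type*} [Fintype Ω] (μ : Ω → ℝ) : Prop :=
  (∀ ω, 0 ≤ μ ω) ∧ ∑ ω : Ω, μ ω = 1

noncomputable def prb {Ω γ : Type*} [Fintype Ω] [DecidableEq γ]
    (μ : Ω → ℝ) (X : Ω → γ) (x : γ) : ℝ := ∑ ω : Ω, if X ω = x then μ ω else 0

lemma sum_prb_mul {Ω γ : Type*} [Fintype Ω] [Fintype γ] [DecidableEq γ]
    (μ : Ω → ℝ) (X : Ω → γ) (g : γ → ℝ) :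
    ∑ x, prb μ X x * g x = ∑ ω, μ ω * g (X ω) := by
  unfold prb
  simp_rw [Finset.sum_mul]
  rw [Finset.sum_comm]
  refine Finset.sum_congr rfl fun ω _ => ?_
  simp [ite_mul]

lemma ent_eq {Ω γ : Type*} [Fintype Ω] [Fintype γ] [DecidableEq γ]
    (μ : Ω → ℝ) (X : Ω → γ) :
    ent μ X = ∑ ω, μ ω * (- Real.log (prb μ X (X ω))) := by
  rw [← sum_prb_mul μ X (fun x => - Real.log (prb μ X x))]
  unfold ent
  refine Finset.sum_congr rfl fun x _ => ?_
  simp [Real.negMulLog, prb]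

lemma prb_nonneg {Ω γ : Type*} [Fintype Ω] [DecidableEq γ]
    {μ : Ω → ℝ} (h : ∀ ω, 0 ≤ μ ω) (X : Ω → γ) (x : γ) : 0 ≤ prb μ X x :=
  Finset.sum_nonneg fun ω _ => by split_ifs <;> simp [h]

lemma le_prb {Ω γ : Type*} [Fintype Ω] [DecidableEq γ]
    {μ : Ω → ℝ} (h : ∀ ω, 0 ≤ μ ω) (X : Ω → γ) (ω : Ω) : μ ω ≤ prb μ X (X ω) := by
  have := Finset.single_le_sum (f := fun ω' => if X ω' = X ω then μ ω' else 0)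
    (fun ω' _ => by split_ifs <;> simp [h]) (Finset.mem_univ ω)
  simpa [prb] using this

lemma ent_mono {Ω γ δ : Type*} [Fintype Ω] [Fintype γ] [DecidableEq γ]
    [Fintype δ] [DecidableEq δ]
    {μ : Ω → ℝ} (h : ∀ ω, 0 ≤ μ ω) (X : Ω → γ) (f : γ → δ) :
    ent μ (fun ω => f (X ω)) ≤ ent μ X := by
  rw [ent_eq, ent_eq]
  refine Finset.sum_le_sum fun ω _ => ?_
  rcases (h ω).eq_or_lt with h0 | h0
  · simp [← h0]
  · refine mul_le_mul_of_nonneg_left (neg_le_neg (Real.log_le_log ?_ ?_)) (h ω)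
    · exact h0.trans_le (le_prb h X ω)
    · refine Finset.sum_le_sum fun ω' _ => ?_
      by_cases hx : X ω' = X ω
      · simp [hx]
      · simp only [hx, if_false]
        split_ifs <;> simp [h]

lemma sum_prb_pair {Ω γ δ : Type*} [Fintype Ω] [Fintype γ] [DecidableEq γ]
    [DecidableEq δ] (μ : Ω → ℝ) (X : Ω → γ) (Z : Ω → δ) (z : δ) :
    ∑ x, prb μ (fun ω => (X ω, Z ω)) (x, z) = prb μ Z z := by
  unfold prb
  rw [Finset.sum_comm]
  refine Finset.sum_congr rfl fun ω _ => ?_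
  by_cases hz : Z ω = z <;> simp [hz]

lemma ent_submod {Ω α β γ : Type*} [Fintype Ω] [Fintype α] [Fintype β] [Fintype γ]
    [DecidableEq α] [DecidableEq β] [DecidableEq γ]
    {μ : Ω → ℝ} (hμ : IsPMF μ) (X : Ω → α) (Y : Ω → β) (Z : Ω → γ) :
    ent μ (fun ω => (X ω, Y ω, Z ω)) + ent μ Z
      ≤ ent μ (fun ω => (X ω, Z ω)) + ent μ (fun ω => (Y ω, Z ω)) := by
  obtain ⟨h, h1⟩ := hμ
  let T : Ω → α × β × γ := fun ω => (X ω, Y ω, Z ω)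
  let t : α × β × γ → ℝ := fun p => prb μ (fun ω => (X ω, Z ω)) (p.1, p.2.2) *
    prb μ (fun ω => (Y ω, Z ω)) p.2 / (prb μ T p * prb μ Z p.2.2)
  have key : ∑ ω, μ ω * t (T ω) ≤ 1 := by
    rw [← sum_prb_mul μ T t]
    calc ∑ p, prb μ T p * t p ≤ ∑ p : α × β × γ, prb μ (fun ω => (X ω, Z ω)) (p.1, p.2.2) *
          prb μ (fun ω => (Y ω, Z ω)) p.2 / prb μ Z p.2.2 := by
          refine Finset.sum_le_sum fun p _ => ?_
          have a := prb_nonneg h (fun ω => (X ω, Z ω)) (p.1, p.2.2)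
          have b := prb_nonneg h (fun ω => (Y ω, Z ω)) p.2
          have c := prb_nonneg h Z p.2.2
          rcases (prb_nonneg h T p).eq_or_lt with h0 | h0
          · rw [← h0, zero_mul]; positivity
          · apply le_of_eq
            simp only [t]
            rw [← mul_div_assoc, mul_div_mul_left _ _ h0.ne']
      _ = ∑ z, prb μ Z z * prb μ Z z / prb μ Z z := by
          rw [Fintype.sum_prod_type]
          simp_rw [Fintype.sum_prod_type_right]
          rw [Finset.sum_comm]
          refine Finset.sum_congr rfl fun z _ => ?_
          simp_rw [← Finset.sum_div, ← Finset.mul_sum, ← Finset.sum_mul, sum_prb_pair]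
      _ = ∑ z, prb μ Z z * 1 := by
          refine Finset.sum_congr rfl fun z _ => ?_
          rw [mul_self_div_self, mul_one]
      _ = 1 := by rw [sum_prb_mul μ Z (fun _ => 1)]; simpa using h1
      _ ≤ 1 := le_rfl
  have pt : ∀ ω, μ ω * (- Real.log (prb μ T (T ω))) + μ ω * (- Real.log (prb μ Z (Z ω)))
      - μ ω * (- Real.log (prb μ (fun ω => (X ω, Z ω)) (X ω, Z ω)))
      - μ ω * (- Real.log (prb μ (fun ω => (Y ω, Z ω)) (Y ω, Z ω))) ≤ μ ω * t (T ω) - μ ω := by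
    intro ω
    rcases (h ω).eq_or_lt with h0 | h0
    · simp [← h0]
    · have a := h0.trans_le (le_prb h (fun ω => (X ω, Z ω)) ω)
      have b := h0.trans_le (le_prb h (fun ω => (Y ω, Z ω)) ω)
      have c := h0.trans_le (le_prb h Z ω)
      have d := h0.trans_le (le_prb h T ω)
      have e : Real.log (t (T ω)) ≤ t (T ω) - 1 := by
        apply Real.log_le_sub_one_of_pos
        exact div_pos (mul_pos a b) (mul_pos d c)
      have e2 : Real.log (t (T ω)) = Real.log (prb μ (fun ω => (X ω, Z ω)) (X ω, Z ω))
          + Real.log (prb μ (fun ω => (Y ω, Z ω)) (Y ω, Z ω))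
          - (Real.log (prb μ T (T ω)) + Real.log (prb μ Z (Z ω))) := by
        rw [← Real.log_mul a.ne' b.ne', ← Real.log_mul d.ne' c.ne',
          ← Real.log_div (mul_pos a b).ne' (mul_pos d c).ne']
      have := mul_le_mul_of_nonneg_left e (h ω)
      rw [e2] at this
      linarith
  have := Finset.sum_le_sum fun ω (_ : ω ∈ Finset.univ) => pt ω
  simp only [Finset.sum_sub_distrib, Finset.sum_add_distrib] at this
  simp only [ent_eq]
  linarith

lemma condEnt_diff {Ω α β γ π : Type*} [Fintype Ω] [Fintype α] [Fintype β] [Fintype γ] [Fintype π]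
    [DecidableEq α] [DecidableEq β] [DecidableEq γ] [DecidableEq π]
    (μ : Ω → ℝ) (hμ : IsPMF μ) (Xa : Ω → α) (Xb : Ω → β) (Y : Ω → γ) (Pi : Ω → π) :
    condEnt μ Y (fun ω => (Pi ω, Xb ω)) - condEnt μ Y (fun ω => (Pi ω, Xa ω))
      ≤ condEnt μ Xa Xb := by
  unfold condEnt
  have s1 := ent_submod hμ Y Xb (fun ω => (Pi ω, Xa ω))
  have s2 := ent_submod hμ Xa Pi Xb
  have m1 := ent_mono hμ.1 (fun ω => (Y ω, Xb ω, Pi ω, Xa ω)) (fun p => (p.1, p.2.2.1, p.2.1))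
  have m2 := ent_mono hμ.1 (fun ω => (Xa ω, Pi ω, Xb ω)) (fun p => (p.2.2, p.2.1, p.1))
  dsimp only at m1 m2
  linarith

theorem condEnt_close_of_noisy_copy_with_target
    {Ω α β γ π : Type*} [Fintype Ω] [Fintype α] [Fintype β] [Fintype γ] [Fintype π]
    [DecidableEq α] [DecidableEq β] [DecidableEq γ] [DecidableEq π]
    (μ : Ω → ℝ) (hμ : IsPMF μ) (Xa : Ω → α) (Xb : Ω → β) (Y : Ω → γ) (Pi : Ω → π)
    (lam : ℝ) (hlam : 0 < lam)
    (hmarkov : condEnt μ Xb (fun ω => (Xa ω, Y ω, Pi ω)) = condEnt μ Xb Xa)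
    (hba : condEnt μ Xb Xa ≤ lam) (hab : condEnt μ Xa Xb ≤ lam) :
    |condEnt μ Y (fun ω => (Pi ω, Xb ω)) - condEnt μ Y (fun ω => (Pi ω, Xa ω))| ≤ 3 * lam := by
  have h1 := condEnt_diff μ hμ Xa Xb Y Pi
  have h2 := condEnt_diff μ hμ Xb Xa Y Pi
  rw [abs_le]
  constructor <;> linarith
end

section
/- Let γ > 0 and V ⊆ {X_1,…,X_d}, and assume condition (1) of (γ,V)-stability holds. Let G* ∈ G_{d,k} be an optimal structure (score(G*) = S*), and let F ⊆ G* be the set of families of the variables in V̄ in G*. Then: (1) G* ∖ F is a DAG over the variables of V with in-degree at most k (i.e., G*∖F ∈ G_V), and (2) score(G* ∖ F) = max_{G ∈ G_V} score(G). -/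
open Finset

/-- The joint value of the tuple of variables `X j` for `j` in the finite set `P`. -/
def tupleOf {d : ℕ} {Ω α : Type*} (X : Fin d → Ω → α) (P : Finset (Fin d)) :
    Ω → ({j // j ∈ P} → α) :=
  fun ω j => X j.1 ω

/-- The entropy H(f) of the family `f = ⟨X_i, P⟩`: the conditional Shannon entropy of the
child variable `X i` given the joint value of its parents, the variables `X j` for `j ∈ P`. -/
noncomputable def famEnt {d : ℕ} {Ω α : Type*} [Fintype Ω] [Fintype α] [DecidableEq α]
    (μ : Ω → ℝ) (X : Fin d → Ω → α) (i : Fin d) (P : Finset (Fin d)) : ℝ :=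
  condEnt μ (X i) (tupleOf X P)

/-- A relation is acyclic if no (nonempty) directed path leads from a vertex to itself. -/
def Acyclic {V : Type*} (r : V → V → Prop) : Prop :=
  ∀ v, ¬ Relation.TransGen r v v

/-- A graph over the `d` variables, given as the assignment `g` of a parent set to each
child variable, is in `𝒢_{d,k}`: no variable is its own parent, every variable has at
most `k` parents, and the parent → child edge relation is acyclic. -/
def IsDAGdk {d : ℕ} (k : ℕ) (g : Fin d → Finset (Fin d)) : Prop :=
  (∀ i, i ∉ g i ∧ (g i).card ≤ k) ∧ Acyclic (fun u w => u ∈ g w)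

/-- The score of the graph `g`: minus the sum of the entropies of its families. -/
noncomputable def score {d : ℕ} {Ω α : Type*} [Fintype Ω] [Fintype α] [DecidableEq α]
    (μ : Ω → ℝ) (X : Fin d → Ω → α) (g : Fin d → Finset (Fin d)) : ℝ :=
  -∑ i : Fin d, famEnt μ X i (g i)

/-- `S* := max_{G ∈ 𝒢_{d,k}} score(G)`, the optimal score. -/
noncomputable def Sstar {d : ℕ} {Ω α : Type*} [Fintype Ω] [Fintype α] [DecidableEq α]
    (k : ℕ) (μ : Ω → ℝ) (X : Fin d → Ω → α) : ℝ :=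
  sSup {s | ∃ g, IsDAGdk k g ∧ score μ X g = s}

/-- `g` restricted to the variables of `W` is a DAG over the variables of `W` with
in-degree at most `k` (all parents of variables of `W` are themselves in `W`). -/
def IsDAGon {d : ℕ} (k : ℕ) (W : Finset (Fin d)) (g : Fin d → Finset (Fin d)) : Prop :=
  (∀ i ∈ W, i ∉ g i ∧ (g i).card ≤ k ∧ g i ⊆ W) ∧
  Acyclic (fun u w => w ∈ W ∧ u ∈ g w)

/-- `g` restricted to `W` is a legal family set for `W`: one family (with at most `k`
parents, drawn from all the variables) for each variable of `W`, with no directed cycle. -/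
def LegalFamSet {d : ℕ} (k : ℕ) (W : Finset (Fin d)) (g : Fin d → Finset (Fin d)) : Prop :=
  (∀ i ∈ W, i ∉ g i ∧ (g i).card ≤ k) ∧ Acyclic (fun u w => w ∈ W ∧ u ∈ g w)

/-- The score of the set of families of the variables of `W` in `g`. -/
noncomputable def scoreOn {d : ℕ} {Ω α : Type*} [Fintype Ω] [Fintype α] [DecidableEq α]
    (μ : Ω → ℝ) (X : Fin d → Ω → α) (W : Finset (Fin d)) (g : Fin d → Finset (Fin d)) : ℝ :=
  -∑ i ∈ W, famEnt μ X i (g i)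

/-- The maximal score over DAGs with in-degree at most `k` over the variables of `W`. -/
noncomputable def SstarOn {d : ℕ} {Ω α : Type*} [Fintype Ω] [Fintype α] [DecidableEq α]
    (k : ℕ) (W : Finset (Fin d)) (μ : Ω → ℝ) (X : Fin d → Ω → α) : ℝ :=
  sSup {s | ∃ g, IsDAGon k W g ∧ scoreOn μ X W g = s}

/-- `X b` is a noisy copy of `X a` with parameter `lam`: `X b` is conditionally
independent of every subset `S` of the remaining variables given `X a` (expressed by
`H(X_b ∣ X_a, S) = H(X_b ∣ X_a)`), and `max(H(X_b ∣ X_a), H(X_a ∣ X_b)) ≤ lam`. -/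
def NoisyCopy {d : ℕ} {Ω α : Type*} [Fintype Ω] [Fintype α] [DecidableEq α]
    (μ : Ω → ℝ) (X : Fin d → Ω → α) (a b : Fin d) (lam : ℝ) : Prop :=
  (∀ S : Finset (Fin d), a ∉ S → b ∉ S →
      condEnt μ (X b) (fun ω => (X a ω, tupleOf X S ω)) = condEnt μ (X b) (X a)) ∧
  condEnt μ (X b) (X a) ≤ lam ∧ condEnt μ (X a) (X b) ≤ lam

theorem optimal_restriction_to_stable_set
    {d k : ℕ} {Ω α : Type*} [Fintype Ω] [Fintype α] [DecidableEq α]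
    (hd : 1 ≤ d) (hk : 1 ≤ k)
    (μ : Ω → ℝ) (hμ : IsPMF μ) (X : Fin d → Ω → α)
    (γ : ℝ) (hγ : 0 < γ) (V : Finset (Fin d))
    (hstable : ∀ g, IsDAGdk k g → score μ X g ≥ Sstar k μ X - γ → ∀ i ∈ V, g i ⊆ V)
    (Gstar : Fin d → Finset (Fin d)) (hG : IsDAGdk k Gstar)
    (hopt : ∀ g, IsDAGdk k g → score μ X g ≤ score μ X Gstar) :
    IsDAGon k V Gstar ∧
      ∀ g, IsDAGon k V g → scoreOn μ X V g ≤ scoreOn μ X V Gstar := by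
  have hS : Sstar k μ X ≤ score μ X Gstar := by
    refine csSup_le (⟨score μ X Gstar, Gstar, hG, rfl⟩ : Set.Nonempty {s | ∃ g, IsDAGdk k g ∧ score μ X g = s}) ?_
    rintro s ⟨g, hg, rfl⟩
    exact hopt g hg
  have hsub := hstable Gstar hG (by linarith)
  refine ⟨⟨fun i hi => ⟨(hG.1 i).1, (hG.1 i).2, hsub i hi⟩, fun v hv =>
    hG.2 v (Relation.TransGen.mono (r := fun u w => w ∈ V ∧ u ∈ Gstar w) (fun _ _ h => h.2) v v hv)⟩, ?_⟩
  intro g hg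
  let h : Fin d → Finset (Fin d) := fun i => if i ∈ V then g i else Gstar i
  have hin : ∀ i, i ∈ V → h i = g i := fun i hi => if_pos hi
  have hout : ∀ i, i ∉ V → h i = Gstar i := fun i hi => if_neg hi
  have hh : IsDAGdk k h := by
    constructor
    · intro i
      by_cases hi : i ∈ V
      · rw [hin i hi]; exact ⟨(hg.1 i hi).1, (hg.1 i hi).2.1⟩
      · rw [hout i hi]; exact hG.1 i
    · intro v hv
      by_cases hvV : v ∈ V
      · have key : ∀ u w, Relation.TransGen (fun u w => u ∈ h w) u w → w ∈ V →
            u ∈ V ∧ Relation.TransGen (fun u w => w ∈ V ∧ u ∈ g w) u w := by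
          intro u w huw
          induction huw with
          | single e =>
            intro hw
            rw [hin _ hw] at e
            exact ⟨(hg.1 _ hw).2.2 e, .single ⟨hw, e⟩⟩
          | tail _ e ih =>
            intro hw
            rw [hin _ hw] at e
            obtain ⟨h1, h2⟩ := ih ((hg.1 _ hw).2.2 e)
            exact ⟨h1, h2.tail ⟨hw, e⟩⟩
        exact hg.2 v (key v v hv hvV).2
      · have step : ∀ u w, u ∈ h w → u ∉ V → w ∉ V := by
          intro u w e hu hw
          rw [hin _ hw] at e
          exact hu ((hg.1 _ hw).2.2 e)
        have key : ∀ w, Relation.TransGen (fun u w => u ∈ h w) v w →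
            w ∉ V ∧ Relation.TransGen (fun u w => u ∈ Gstar w) v w := by
          intro w huw
          induction huw with
          | single e =>
            have hw := step _ _ e hvV
            rw [hout _ hw] at e
            exact ⟨hw, .single e⟩
          | tail _ e ih =>
            have hw := step _ _ e ih.1
            rw [hout _ hw] at e
            exact ⟨hw, ih.2.tail e⟩
        exact hG.2 v (key v hv).2
  have hle := hopt h hh
  unfold score at hle
  unfold scoreOn
  rw [← Finset.sum_add_sum_compl V (fun i => famEnt μ X i (h i)),
    ← Finset.sum_add_sum_compl V (fun i => famEnt μ X i (Gstar i)),
    Finset.sum_congr rfl (fun i hi => by rw [hin i hi] :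
      ∀ i ∈ V, famEnt μ X i (h i) = famEnt μ X i (g i)),
    Finset.sum_congr rfl (fun i hi => by rw [hout i (Finset.mem_compl.1 hi)] :
      ∀ i ∈ Vᶜ, famEnt μ X i (h i) = famEnt μ X i (Gstar i))] at hle
  linarith
end

section
/- Let γ > 0 and V ⊆ {X_1,…,X_d}, and assume condition (1) of (γ,V)-stability holds. Let G* ∈ G_{d,k} be an optimal structure (score(G*) = S*), and let F ⊆ G* be the set of families of the variables in V̄ in G*. Then score(F) ≥ score(F') for every legal family set F' for V̄; that is, F has maximal score among the legal family sets for V̄. -/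
open Finset

theorem optimal_families_of_complement
    {d k : ℕ} {Ω α : Type*} [Fintype Ω] [Fintype α] [DecidableEq α]
    (hd : 1 ≤ d) (hk : 1 ≤ k)
    (μ : Ω → ℝ) (hμ : IsPMF μ) (X : Fin d → Ω → α)
    (γ : ℝ) (hγ : 0 < γ) (V : Finset (Fin d))
    (hstable : ∀ g, IsDAGdk k g → score μ X g ≥ Sstar k μ X - γ → ∀ i ∈ V, g i ⊆ V)
    (Gstar : Fin d → Finset (Fin d)) (hG : IsDAGdk k Gstar)
    (hopt : ∀ g, IsDAGdk k g → score μ X g ≤ score μ X Gstar) :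
    ∀ F', LegalFamSet k (Finset.univ \ V) F' →
      scoreOn μ X (Finset.univ \ V) F' ≤ scoreOn μ X (Finset.univ \ V) Gstar := by
  intro F' hF
  have hne : score μ X Gstar ≥ Sstar k μ X - γ := by
    have h : Sstar k μ X ≤ score μ X Gstar := by
      refine csSup_le (s := {s | ∃ g, IsDAGdk k g ∧ score μ X g = s}) ⟨_, Gstar, hG, rfl⟩ ?_
      rintro s ⟨g, hg, rfl⟩
      exact hopt g hg
    linarith
  have hV := hstable Gstar hG hne
  let g : Fin d → Finset (Fin d) := fun i => if i ∈ V then Gstar i else F' i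
  have gV : ∀ i, i ∈ V → g i = Gstar i := fun i hi => if_pos hi
  have gN : ∀ i, i ∉ V → g i = F' i := fun i hi => if_neg hi
  have hg : IsDAGdk k g := by
    refine ⟨fun i => ?_, fun v hv => ?_⟩
    · by_cases hi : i ∈ V
      · rw [gV i hi]; exact hG.1 i
      · rw [gN i hi]; exact hF.1 i (by simp [hi])
    · by_cases hvV : v ∈ V
      · have key : ∀ a b, Relation.TransGen (fun u w => u ∈ g w) a b → b ∈ V →
            a ∈ V ∧ Relation.TransGen (fun u w => u ∈ Gstar w) a b := by
          intro a b hab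
          induction hab with
          | single h =>
            intro hb
            rw [gV _ hb] at h
            exact ⟨hV _ hb h, .single h⟩
          | tail _ h ih =>
            intro hb
            rw [gV _ hb] at h
            obtain ⟨h1, h2⟩ := ih (hV _ hb h)
            exact ⟨h1, h2.tail h⟩
        exact hG.2 v (key v v hv hvV).2
      · have step : ∀ a b, a ∈ g b → a ∉ V → b ∉ V ∧ a ∈ F' b := by
          intro a b h ha
          by_cases hb : b ∈ V
          · rw [gV _ hb] at h
            exact absurd (hV _ hb h) ha
          · rw [gN _ hb] at h
            exact ⟨hb, h⟩
        have key : ∀ a b, Relation.TransGen (fun u w => u ∈ g w) a b → a ∉ V →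
            b ∉ V ∧ Relation.TransGen (fun u w => w ∈ Finset.univ \ V ∧ u ∈ F' w) a b := by
          intro a b hab ha
          induction hab with
          | single h =>
            obtain ⟨h1, h2⟩ := step _ _ h ha
            exact ⟨h1, .single ⟨by simp [h1], h2⟩⟩
          | tail _ h ih =>
            obtain ⟨h1, h2⟩ := step _ _ h ih.1
            exact ⟨h1, ih.2.tail ⟨by simp [h1], h2⟩⟩
        exact hF.2 v (key v v hv hvV).2
  have hle := hopt g hg
  unfold score at hle
  unfold scoreOn
  rw [← Finset.sum_sdiff (Finset.subset_univ V),
    ← Finset.sum_sdiff (Finset.subset_univ V) (f := fun i => famEnt μ X i (Gstar i))] at hle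
  have e1 : ∑ i ∈ V, famEnt μ X i (g i) = ∑ i ∈ V, famEnt μ X i (Gstar i) :=
    Finset.sum_congr rfl fun i hi => by rw [gV i hi]
  have e2 : ∑ i ∈ Finset.univ \ V, famEnt μ X i (g i)
      = ∑ i ∈ Finset.univ \ V, famEnt μ X i (F' i) :=
    Finset.sum_congr rfl fun i hi => by rw [gN i (by simpa using hi)]
  rw [e1, e2] at hle
  linarith
end

section
/- Let X_a be one of the variables X_1,…,X_d, let V := {X_1,…,X_d}∖{X_a}, let S̄ denote the maximal score over DAGs in G_{d,k} (over all d variables), and let S̄_V denote the maximal score over DAGs with in-degree at most k over the variables of V. Let β > 0 and assume: (i) every G ∈ G_{d,k} with score(G) < S̄ satisfies score(G) ≤ S̄ − β; and (ii) in every G ∈ G_{d,k} with score(G) = S̄, the variable X_a has no children. Then every DAG H with in-degree at most k over the variables of V with score(H) < S̄_V satisfies score(H) ≤ S̄_V − β. -/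
open Finset

/-- The score splits into the score on the other variables and the family of `a`. -/
lemma score_split {d : ℕ} {Ω α : Type*} [Fintype Ω] [Fintype α] [DecidableEq α]
    (μ : Ω → ℝ) (X : Fin d → Ω → α) (a : Fin d) (g : Fin d → Finset (Fin d)) :
    score μ X g = scoreOn μ X (Finset.univ.erase a) g - famEnt μ X a (g a) := by
  unfold score scoreOn
  rw [← Finset.add_sum_erase Finset.univ _ (Finset.mem_univ a)]
  ring

lemma scoreOn_update {d : ℕ} {Ω α : Type*} [Fintype Ω] [Fintype α] [DecidableEq α]
    (μ : Ω → ℝ) (X : Fin d → Ω → α) (a : Fin d) (g : Fin d → Finset (Fin d))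
    (P : Finset (Fin d)) :
    scoreOn μ X (Finset.univ.erase a) (Function.update g a P)
      = scoreOn μ X (Finset.univ.erase a) g := by
  unfold scoreOn
  congr 1
  refine Finset.sum_congr rfl fun i hi => ?_
  rw [Function.update_of_ne (Finset.ne_of_mem_erase hi)]

/-- Adding `a` as a childless variable to a DAG over the others gives a DAG. -/
lemma isDAGdk_update {d k : ℕ} (a : Fin d) (g : Fin d → Finset (Fin d))
    (hg : IsDAGon k (Finset.univ.erase a) g) (P : Finset (Fin d)) (haP : a ∉ P)
    (hP : P.card ≤ k) : IsDAGdk k (Function.update g a P) := by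
  have hne : ∀ u w, u ∈ Function.update g a P w → u ≠ a := by
    intro u w hu hua
    subst hua
    by_cases hw : w = u
    · subst hw
      simp at hu
      exact haP hu
    · rw [Function.update_of_ne hw] at hu
      have := (hg.1 w (by simp [hw])).2.2 hu
      simp at this
  refine ⟨fun i => ?_, fun v hv => ?_⟩
  · by_cases hi : i = a
    · subst hi
      simpa using ⟨haP, hP⟩
    · rw [Function.update_of_ne hi]
      have := hg.1 i (by simp [hi])
      exact ⟨this.1, this.2.1⟩
  · have key : ∀ w, Relation.TransGen (fun u w => u ∈ Function.update g a P w) v w → w ≠ a →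
        Relation.TransGen (fun u w => w ∈ Finset.univ.erase a ∧ u ∈ g w) v w := by
      intro w hw
      induction hw with
      | single hu =>
        intro hwa
        rw [Function.update_of_ne hwa] at hu
        exact .single ⟨by simp [hwa], hu⟩
      | tail _ hu ih =>
        intro hwa
        have h1 := ih (hne _ _ hu)
        rw [Function.update_of_ne hwa] at hu
        exact h1.tail ⟨by simp [hwa], hu⟩
    have hva : v ≠ a := by
      obtain ⟨c, hc, -⟩ := Relation.TransGen.head'_iff.1 hv
      exact hne _ _ hc
    exact hg.2 v (key v hv hva)

theorem score_gap_restricted_of_gap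
    {d k : ℕ} {Ω α : Type*} [Fintype Ω] [Fintype α] [DecidableEq α]
    (hd : 1 ≤ d) (hk : 1 ≤ k)
    (μ : Ω → ℝ) (hμ : IsPMF μ) (X : Fin d → Ω → α)
    (a : Fin d) (β : ℝ) (hβ : 0 < β)
    (hgap : ∀ g, IsDAGdk k g → score μ X g < Sstar k μ X →
      score μ X g ≤ Sstar k μ X - β)
    (hnochild : ∀ g, IsDAGdk k g → score μ X g = Sstar k μ X → ∀ w, a ∉ g w)
    (h : Fin d → Finset (Fin d)) (hh : IsDAGon k (Finset.univ.erase a) h)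
    (hlt : scoreOn μ X (Finset.univ.erase a) h < SstarOn k (Finset.univ.erase a) μ X) :
    scoreOn μ X (Finset.univ.erase a) h ≤ SstarOn k (Finset.univ.erase a) μ X - β := by
  set W := Finset.univ.erase a with hW
  have hfin : {s | ∃ g, IsDAGdk k g ∧ score μ X g = s}.Finite :=
    (Set.toFinite {g | IsDAGdk k g}).image (score μ X)
  have hfinW : {s | ∃ g, IsDAGon k W g ∧ scoreOn μ X W g = s}.Finite :=
    (Set.toFinite {g | IsDAGon k W g}).image (scoreOn μ X W)
  have hnon : {s | ∃ g, IsDAGdk k g ∧ score μ X g = s}.Nonempty :=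
    ⟨_, _, isDAGdk_update a h hh ∅ (by simp) (by simp), rfl⟩
  have hnonW : {s | ∃ g, IsDAGon k W g ∧ scoreOn μ X W g = s}.Nonempty := ⟨_, h, hh, rfl⟩
  obtain ⟨G, hG, hGs⟩ : ∃ g, IsDAGdk k g ∧ score μ X g = Sstar k μ X := hnon.csSup_mem hfin
  obtain ⟨K, hK, hKs⟩ : ∃ g, IsDAGon k W g ∧ scoreOn μ X W g = SstarOn k W μ X :=
    hnonW.csSup_mem hfinW
  have hGa := hnochild G hG hGs
  have hup : ∀ g, IsDAGon k W g → IsDAGdk k (Function.update g a (G a)) := fun g hg =>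
    isDAGdk_update a g hg (G a) (hGa a) (hG.1 a).2
  have hsc : ∀ g, score μ X (Function.update g a (G a))
      = scoreOn μ X W g - famEnt μ X a (G a) := by
    intro g
    rw [score_split μ X a, scoreOn_update, Function.update_self]
  have hGW : IsDAGon k W G := by
    refine ⟨fun i _ => ⟨(hG.1 i).1, (hG.1 i).2, fun u hu => ?_⟩, fun v hv => ?_⟩
    · rw [hW, Finset.mem_erase]
      refine ⟨?_, Finset.mem_univ _⟩
      rintro rfl
      exact hGa i hu
    · exact hG.2 v (Relation.TransGen.mono (r := fun u w => w ∈ W ∧ u ∈ G w)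
        (p := fun u w => u ∈ G w) (fun _ _ hu => hu.2) v v hv)
  have h1 : scoreOn μ X W G ≤ SstarOn k W μ X := le_csSup hfinW.bddAbove ⟨G, hGW, rfl⟩
  have h2 : score μ X (Function.update K a (G a)) ≤ Sstar k μ X :=
    le_csSup hfin.bddAbove ⟨_, hup K hK, rfl⟩
  have h3 := score_split μ X a G
  rw [← hW] at h3
  rw [hsc] at h2
  have h4 := hgap _ (hup h hh)
  rw [hsc] at h4
  have h5 := h4 (by linarith)
  linarith
end

section
/- Let X_a be a discrete random variable and Π a finite tuple of discrete random variables, all with finite supports. Let C be a {0,1}-valued random variable independent of the pair (X_a, Π) with P(C = 0) > 0, and let X_b be a random variable such that P(X_b = X_a ∣ C = 1) = 1 and X_b is conditionally independent of (X_a, Π) given C = 0. If H(Π ∣ X_a) < H(Π), then H(Π ∣ X_b) > H(Π ∣ X_a). -/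
open Finset

open Classical in
/-- The probability of the event `E` under the pmf `μ`. -/
noncomputable def pr {Ω : Type*} [Fintype Ω] (μ : Ω → ℝ) (E : Ω → Prop) : ℝ :=
  ∑ ω : Ω, if E ω then μ ω else 0

/-- The perspective function of entropy. -/
noncomputable def FF (u v : ℝ) : ℝ := Real.negMulLog u + u * Real.log v

lemma FF_le (u v k : ℝ) (hu : 0 ≤ u) (huv : u ≤ v) (hk : 0 < k) :
    FF u v ≤ -u * Real.log k + k * v - u := by
  unfold FF Real.negMulLog
  rcases hu.eq_or_lt with h | h
  · subst h
    have : 0 ≤ k * v := mul_nonneg hk.le huv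
    simpa using this
  · have hv : 0 < v := h.trans_le huv
    have h1 := Real.log_le_sub_one_of_pos (show 0 < k * v / u by positivity)
    rw [Real.log_div (by positivity) h.ne', Real.log_mul hk.ne' hv.ne'] at h1
    have h2 := mul_le_mul_of_nonneg_left h1 hu
    have h3 : u * (k * v / u - 1) = k * v - u := by field_simp
    rw [h3] at h2
    linarith

lemma FF_add (u v u' v' : ℝ) (hu : 0 ≤ u) (huv : u ≤ v) (hu' : 0 ≤ u') (huv' : u' ≤ v') :
    FF u v + FF u' v' ≤ FF (u + u') (v + v') := by
  rcases (add_nonneg hu hu').eq_or_lt with h | h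
  · have h1 : u = 0 := by linarith
    have h2 : u' = 0 := by linarith
    subst h1; subst h2
    simp [FF]
  · have hv : 0 < v + v' := by linarith
    have hk : 0 < (u + u') / (v + v') := by positivity
    have h1 := FF_le u v _ hu huv hk
    have h2 := FF_le u' v' _ hu' huv' hk
    have h3 : FF (u + u') (v + v') = -(u + u') * Real.log ((u + u') / (v + v')) := by
      rw [Real.log_div h.ne' hv.ne']
      unfold FF Real.negMulLog
      ring
    have h4 : (u + u') / (v + v') * v + (u + u') / (v + v') * v' = u + u' := by
      field_simp
    rw [h3]
    linarith

lemma FF_smul (c u v : ℝ) (hu : 0 ≤ u) (huv : u ≤ v) :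
    FF (c * u) (c * v) = c * FF u v := by
  unfold FF Real.negMulLog
  rcases eq_or_ne c 0 with h | h
  · simp [h]
  rcases hu.eq_or_lt with h' | h'
  · subst h'; simp
  · have hv : 0 < v := h'.trans_le huv
    rw [Real.log_mul h h'.ne', Real.log_mul h hv.ne']
    ring

lemma key_ineq {α π : Type*} [Fintype α] [Fintype π] (p : α → π → ℝ) (r : α → ℝ) (t s : ℝ)
    (hp : ∀ x z, 0 ≤ p x z) (hp1 : ∑ z, ∑ x, p x z = 1) (hr : ∀ x, 0 ≤ r x)
    (hr1 : ∑ x, r x = 1) (ht : 0 ≤ t) (hs : 0 ≤ s) :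
    t * (∑ x, ∑ z, FF (p x z) (∑ z, p x z)) + s * ∑ z, Real.negMulLog (∑ x, p x z) ≤
    ∑ x, ∑ z, FF (t * p x z + s * r x * ∑ x', p x' z)
      (∑ z, (t * p x z + s * r x * ∑ x', p x' z)) := by
  have e : s * ∑ z, Real.negMulLog (∑ x, p x z) =
      ∑ x, ∑ z, (s * r x) * FF (∑ x', p x' z) 1 := by
    simp only [FF, Real.log_one, mul_zero, add_zero]
    simp_rw [← Finset.mul_sum, ← Finset.sum_mul, ← Finset.mul_sum, hr1, mul_one]
  rw [e, Finset.mul_sum, ← Finset.sum_add_distrib]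
  refine Finset.sum_le_sum fun x _ => ?_
  rw [Finset.mul_sum, ← Finset.sum_add_distrib]
  refine Finset.sum_le_sum fun z _ => ?_
  have hq : ∀ z, 0 ≤ ∑ x', p x' z := fun z => Finset.sum_nonneg fun x' _ => hp x' z
  have hq1 : ∑ x', p x' z ≤ 1 := by
    rw [← hp1]
    exact Finset.single_le_sum (f := fun z => ∑ x', p x' z) (fun z _ => hq z) (Finset.mem_univ z)
  have hpx : p x z ≤ ∑ z, p x z :=
    Finset.single_le_sum (f := fun z => p x z) (fun z _ => hp x z) (Finset.mem_univ z)
  rw [Finset.sum_add_distrib, ← Finset.mul_sum, ← Finset.mul_sum, hp1,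
    ← FF_smul t _ _ (hp x z) hpx, ← FF_smul (s * r x) _ _ (hq z) hq1]
  have hsr : 0 ≤ s * r x := mul_nonneg hs (hr x)
  exact FF_add _ _ _ _ (mul_nonneg ht (hp x z)) (mul_le_mul_of_nonneg_left hpx ht)
    (mul_nonneg hsr (hq z)) (mul_le_mul_of_nonneg_left hq1 hsr)

lemma ent_eq_pr {Ω γ : Type*} [Fintype Ω] [Fintype γ] [DecidableEq γ]
    (μ : Ω → ℝ) (X : Ω → γ) : ent μ X = ∑ x, Real.negMulLog (pr μ (fun ω => X ω = x)) := by
  unfold ent pr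
  refine Finset.sum_congr rfl fun x _ => ?_
  congr 1
  refine Finset.sum_congr rfl fun ω _ => ?_
  split_ifs <;> rfl

lemma pr_split {Ω γ : Type*} [Fintype Ω] [Fintype γ]
    (μ : Ω → ℝ) (X : Ω → γ) (E : Ω → Prop) :
    pr μ E = ∑ x, pr μ (fun ω => X ω = x ∧ E ω) := by
  classical
  unfold pr
  rw [Finset.sum_comm]
  refine Finset.sum_congr rfl fun ω _ => ?_
  by_cases h : E ω <;> simp [h]

lemma pr_nonneg {Ω : Type*} [Fintype Ω] (μ : Ω → ℝ) (hμ : IsPMF μ) (E : Ω → Prop) :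
    0 ≤ pr μ E := by
  classical
  unfold pr
  refine Finset.sum_nonneg fun ω _ => ?_
  split_ifs
  · exact hμ.1 ω
  · exact le_rfl

lemma pr_congr {Ω : Type*} [Fintype Ω] (μ : Ω → ℝ) (E F : Ω → Prop)
    (h : ∀ ω, μ ω ≠ 0 → (E ω ↔ F ω)) : pr μ E = pr μ F := by
  classical
  unfold pr
  refine Finset.sum_congr rfl fun ω _ => ?_
  by_cases h0 : μ ω = 0
  · simp [h0]
  · simp [h ω h0]

lemma condEnt_eq_s14 {Ω α π : Type*} [Fintype Ω] [Fintype α] [Fintype π] [DecidableEq α]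
    [DecidableEq π] (μ : Ω → ℝ) (Pi : Ω → π) (X : Ω → α) (m : α → π → ℝ)
    (hm : ∀ x z, pr μ (fun ω => Pi ω = z ∧ X ω = x) = m x z) :
    condEnt μ Pi X = ∑ x, ∑ z, FF (m x z) (∑ z, m x z) := by
  have hX : ∀ x, pr μ (fun ω => X ω = x) = ∑ z, m x z := by
    intro x
    rw [pr_split μ Pi]
    exact Finset.sum_congr rfl fun z _ => hm x z
  unfold condEnt
  rw [ent_eq_pr, ent_eq_pr, Fintype.sum_prod_type_right]
  simp only [Prod.mk.injEq, hm, hX, FF, Finset.sum_add_distrib, ← Finset.sum_mul]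
  simp only [Real.negMulLog, neg_mul, Finset.sum_neg_distrib]
  ring

theorem condEnt_noisy_copy_strict
    {Ω α π : Type*} [Fintype Ω] [Fintype α] [Fintype π] [DecidableEq α] [DecidableEq π]
    (μ : Ω → ℝ) (hμ : IsPMF μ)
    (Xa : Ω → α) (Pi : Ω → π) (Xb : Ω → α) (C : Ω → Bool)
    (hindep : ∀ (c : Bool) (x : α × π),
      pr μ (fun ω => C ω = c ∧ (Xa ω, Pi ω) = x) =
        pr μ (fun ω => C ω = c) * pr μ (fun ω => (Xa ω, Pi ω) = x))
    (hC0 : 0 < pr μ (fun ω => C ω = false))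
    (hcopy : pr μ (fun ω => C ω = true ∧ Xb ω = Xa ω) = pr μ (fun ω => C ω = true))
    (hcondindep : ∀ (y : α) (x : α × π),
      pr μ (fun ω => Xb ω = y ∧ (Xa ω, Pi ω) = x ∧ C ω = false) *
          pr μ (fun ω => C ω = false) =
        pr μ (fun ω => Xb ω = y ∧ C ω = false) *
          pr μ (fun ω => (Xa ω, Pi ω) = x ∧ C ω = false))
    (hlt : condEnt μ Pi Xa < ent μ Pi) :
    condEnt μ Pi Xa < condEnt μ Pi Xb := by
  classical
  set s := pr μ (fun ω => C ω = false) with hs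
  set t := pr μ (fun ω => C ω = true) with ht
  have htot : pr μ (fun _ => True) = 1 := by simpa [pr] using hμ.2
  have hts : t + s = 1 := by
    rw [← htot, pr_split μ C]
    simp [hs, ht]
  have hcopy' : ∀ ω, μ ω ≠ 0 → C ω = true → Xb ω = Xa ω := by
    intro ω h0 hc
    by_contra hne
    have h1 : t = pr μ (fun ω => C ω = true ∧ Xb ω = Xa ω)
        + pr μ (fun ω => C ω = true ∧ Xb ω ≠ Xa ω) := by
      rw [ht]
      unfold pr
      rw [← Finset.sum_add_distrib]
      refine Finset.sum_congr rfl fun ω _ => ?_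
      by_cases a : C ω = true <;> by_cases b : Xb ω = Xa ω <;> simp [a, b]
    have h2 : pr μ (fun ω => C ω = true ∧ Xb ω ≠ Xa ω) = 0 := by linarith
    unfold pr at h2
    rw [Finset.sum_eq_zero_iff_of_nonneg] at h2
    · have := h2 ω (Finset.mem_univ _)
      simp [hc, hne] at this
      exact h0 this
    · intro ω _
      split_ifs
      · exact hμ.1 ω
      · exact le_rfl
  set p : α → π → ℝ := fun x z => pr μ (fun ω => (Xa ω, Pi ω) = (x, z)) with hp
  set r : α → ℝ := fun y => pr μ (fun ω => Xb ω = y ∧ C ω = false) / s with hr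
  have hpi : ∀ z, pr μ (fun ω => Pi ω = z) = ∑ x, p x z := by
    intro z
    rw [pr_split μ Xa]
    simp [hp]
  have hp1 : ∑ z, ∑ x, p x z = 1 := by
    rw [← htot, pr_split μ Pi]
    simp [← hpi]
  have hr1 : ∑ x, r x = 1 := by
    simp only [hr]
    rw [← Finset.sum_div, ← pr_split μ Xb, ← hs, div_self hC0.ne']
  have ha : condEnt μ Pi Xa = ∑ x, ∑ z, FF (p x z) (∑ z, p x z) := by
    refine condEnt_eq_s14 μ Pi Xa p fun x z => pr_congr _ _ _ fun ω _ => ?_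
    simp [and_comm]
  have hb : condEnt μ Pi Xb = ∑ x, ∑ z, FF (t * p x z + s * r x * ∑ x', p x' z)
      (∑ z, (t * p x z + s * r x * ∑ x', p x' z)) := by
    refine condEnt_eq_s14 μ Pi Xb (fun x z => t * p x z + s * r x * ∑ x', p x' z) fun x z => ?_
    rw [pr_split μ C, Fintype.sum_bool]
    congr 1
    · rw [ht, hp, ← hindep]
      refine pr_congr _ _ _ fun ω h0 => ?_
      have := hcopy' ω h0
      simp only [Prod.mk.injEq]
      constructor
      · rintro ⟨h1, h2, h3⟩
        exact ⟨h1, by rw [← this h1, h3], h2⟩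
      · rintro ⟨h1, h2, h3⟩
        exact ⟨h1, h3, by rw [this h1, h2]⟩
    · rw [pr_split μ Xa, Finset.mul_sum]
      refine Finset.sum_congr rfl fun x' _ => ?_
      have h1 := hcondindep x (x', z)
      have h2 := hindep false (x', z)
      have h3 : pr μ (fun ω => (Xa ω, Pi ω) = (x', z) ∧ C ω = false) = s * p x' z := by
        rw [← h2]
        exact pr_congr _ _ _ fun ω _ => and_comm
      have h4 : pr μ (fun ω => Xa ω = x' ∧ C ω = false ∧ Pi ω = z ∧ Xb ω = x) =
          pr μ (fun ω => Xb ω = x ∧ (Xa ω, Pi ω) = (x', z) ∧ C ω = false) := by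
        refine pr_congr _ _ _ fun ω _ => ?_
        simp only [Prod.mk.injEq]
        tauto
      have h5 : s * r x = pr μ (fun ω => Xb ω = x ∧ C ω = false) := by
        simp only [hr]
        field_simp
      rw [h4, h5]
      rw [h3] at h1
      apply mul_right_cancel₀ hC0.ne'
      rw [h1]
      ring
  have he : ent μ Pi = ∑ z, Real.negMulLog (∑ x, p x z) := by
    rw [ent_eq_pr]
    simp only [hpi]
  have hkey := key_ineq p r t s (fun x z => pr_nonneg μ hμ _) hp1
    (fun x => div_nonneg (pr_nonneg μ hμ _) hC0.le) hr1 (pr_nonneg μ hμ _) hC0.le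
  rw [← ha, ← hb, ← he] at hkey
  have h6 := mul_lt_mul_of_pos_left hlt hC0
  have h7 : condEnt μ Pi Xa = t * condEnt μ Pi Xa + s * condEnt μ Pi Xa := by
    rw [← add_mul, hts, one_mul]
  linarith
end

section
/- Let R be an acyclic relation (the edge relation of a finite DAG) on a finite vertex set, and let a and b be distinct vertices such that there is no directed path from b to a in R. Define R' by removing every edge (b,w) from R and adding the edge (a,w) for every w that was a child of b in R. Then R' is acyclic. -/
/-- Redirecting all out-edges of `b` to come out of `a` instead preserves acyclicity,
provided there is no directed path from `b` to `a`. Here a directed graph is given by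
its edge relation `R`, and acyclicity means no vertex has a (nonempty) directed path
to itself, i.e. `¬ Relation.TransGen R v v` for all `v`. -/
theorem redirect_children_acyclic {V : Type*} [Fintype V] (R : V → V → Prop)
    (hacyc : ∀ v, ¬ Relation.TransGen R v v)
    (a b : V) (hab : a ≠ b) (hpath : ¬ Relation.TransGen R b a) :
    ∀ v, ¬ Relation.TransGen (fun u w => (R u w ∧ u ≠ b) ∨ (u = a ∧ R b w)) v v := by
  have key : ∀ u w, Relation.TransGen (fun u w => (R u w ∧ u ≠ b) ∨ (u = a ∧ R b w)) u w →
      Relation.TransGen R u w ∨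
        (Relation.TransGen R b w ∧ (u = a ∨ Relation.TransGen R u a)) := by
    intro u w h
    induction h with
    | single h =>
      rcases h with ⟨h, _⟩ | ⟨h, h'⟩
      · exact Or.inl (.single h)
      · exact Or.inr ⟨.single h', Or.inl h⟩
    | tail _ h ih =>
      rcases h with ⟨h, _⟩ | ⟨rfl, h'⟩
      · rcases ih with ih | ⟨ih, hu⟩
        · exact Or.inl (ih.tail h)
        · exact Or.inr ⟨ih.tail h, hu⟩
      · rcases ih with ih | ⟨_, hu⟩
        · exact Or.inr ⟨.single h', Or.inr ih⟩
        · exact Or.inr ⟨.single h', hu⟩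
  intro v hv
  rcases key v v hv with h | ⟨h, rfl | h'⟩
  · exact hacyc v h
  · exact hpath h
  · exact hpath (h.trans h')
end

section
/- Let G be a finite DAG in which each vertex v has parent set Π_v, and let a and b be distinct vertices such that there is a directed path from b to a in G. Define a new graph G̃ with parent sets Π̃_v as follows: Π̃_a := Π_b; Π̃_b := (Π_a ∖ {b}) ∪ {a} if b ∈ Π_a, and Π̃_b := Π_a otherwise; for every vertex w ≠ a with b ∈ Π_w, Π̃_w := (Π_w ∖ {b}) ∪ {a}; and Π̃_v := Π_v for all other vertices v. Then G̃ is a DAG. -/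
/-- Swapping the roles of two vertices `a` and `b` (where `b` has a directed path to `a`):
`a` takes `b`'s parents, `b` takes `a`'s parents (with `b` replaced by `a` if needed), and
every other child of `b` becomes a child of `a` instead. The resulting graph is a DAG.
A graph is specified by the parent set `Par v` of each vertex `v`, with an edge `u → v`
for every `u ∈ Par v`; acyclicity means no vertex has a directed path to itself. -/
theorem swap_parent_sets_acyclic {V : Type*} [Fintype V] [DecidableEq V]
    (Par : V → Finset V)
    (hacyc : ∀ v, ¬ Relation.TransGen (fun u w => u ∈ Par w) v v)
    (a b : V) (hab : a ≠ b)
    (hpath : Relation.TransGen (fun u w => u ∈ Par w) b a)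
    (Part : V → Finset V)
    (hPa : Part a = Par b)
    (hPb : Part b = if b ∈ Par a then insert a ((Par a).erase b) else Par a)
    (hPw : ∀ w, w ≠ a → w ≠ b → b ∈ Par w → Part w = insert a ((Par w).erase b))
    (hPv : ∀ v, v ≠ a → v ≠ b → b ∉ Par v → Part v = Par v) :
    ∀ v, ¬ Relation.TransGen (fun u w => u ∈ Part w) v v := by
  have hb : ∀ w, b ∉ Part w := by
    intro w hw
    by_cases h1 : w = a
    · subst h1
      rw [hPa] at hw
      exact hacyc b (.single hw)
    by_cases h2 : w = b
    · subst h2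
      rw [hPb] at hw
      split_ifs at hw with h
      · simp [hab.symm] at hw
      · exact h hw
    by_cases h3 : b ∈ Par w
    · rw [hPw w h1 h2 h3] at hw
      simp [hab.symm] at hw
    · rw [hPv w h1 h2 h3] at hw
      exact h3 hw
  -- edges avoiding `b` map to paths of the original graph once `a` is sent to `b`
  have key : ∀ u w, w ≠ b → u ∈ Part w →
      Relation.TransGen (fun u w => u ∈ Par w)
        (if u = a then b else u) (if w = a then b else w) := by
    intro u w hwb hu
    by_cases h1 : w = a
    · subst h1
      rw [hPa] at hu
      rw [if_pos rfl]
      split_ifs with h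
      · subst h
        exact hpath.tail hu
      · exact .single hu
    · rw [if_neg h1]
      by_cases h3 : b ∈ Par w
      · rw [hPw w h1 hwb h3] at hu
        split_ifs with h
        · exact .single h3
        · simp [h] at hu
          exact .single hu.2
      · rw [hPv w h1 hwb h3] at hu
        split_ifs with h
        · subst h
          exact hpath.tail hu
        · exact .single hu
  have path : ∀ u w, Relation.TransGen (fun u w => u ∈ Part w) u w → w ≠ b →
      Relation.TransGen (fun u w => u ∈ Par w)
        (if u = a then b else u) (if w = a then b else w) := by
    intro u w h
    induction h with
    | single h => exact fun hw => key _ _ hw h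
    | tail _ h ih =>
      intro hw
      refine (ih ?_).trans (key _ _ hw h)
      rintro rfl
      exact hb _ h
  intro v hv
  by_cases hvb : v = b
  · subst hvb
    obtain ⟨c, hc, -⟩ := Relation.TransGen.head'_iff.1 hv
    exact hb _ hc
  · exact hacyc _ (path v v hv hvb)
end

section
/- Assume two designated variables X_a and X_b among X_1,…,X_d satisfy the noisy-copy condition with parameter λ > 0. Let F = {f_a, f_b} be a set of two families with children X_a and X_b and parent sets Π̄_a and Π̄_b respectively, and let F̃ = {f̃_a, f̃_b} be obtained from F by exchanging the roles of X_a and X_b: f̃_a := ⟨X_a, σ(Π̄_b)⟩ and f̃_b := ⟨X_b, σ(Π̄_a)⟩, where σ is the map on variable sets that swaps X_a and X_b and fixes all other variables. Then |score(F) − score(F̃)| ≤ 2λ. -/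
open Finset

section Aux

lemma aux_ent_inj {Ω γ δ : Type*} [Fintype Ω] [Fintype γ] [DecidableEq γ]
    [Fintype δ] [DecidableEq δ] (μ : Ω → ℝ) (Y : Ω → γ) (Z : Ω → δ) (g : γ → δ)
    (hg : Function.Injective g) (hZ : ∀ ω, Z ω = g (Y ω)) : ent μ Z = ent μ Y := by
  unfold ent
  symm
  apply Fintype.sum_of_injective g hg
  · intro i hi
    have : ∀ ω, Z ω ≠ i := fun ω h => hi ⟨Y ω, by rw [← hZ, h]⟩
    simp [this]
  · intro x
    simp [hZ, hg.eq_iff]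

lemma aux_fst {Ω γ δ : Type*} [Fintype Ω] [Fintype γ] [DecidableEq γ]
    [DecidableEq δ] (μ : Ω → ℝ) (Y : Ω → γ) (Z : Ω → δ) (z : δ) :
    ∑ y, (∑ ω : Ω, if (Y ω, Z ω) = (y, z) then μ ω else 0)
      = ∑ ω : Ω, if Z ω = z then μ ω else 0 := by
  rw [Finset.sum_comm]
  refine Finset.sum_congr rfl fun ω _ => ?_
  by_cases h : Z ω = z <;> simp [Prod.ext_iff, h]

lemma aux_mono {ι : Type*} [Fintype ι] (f : ι → ℝ) (hf : ∀ i, 0 ≤ f i) :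
    Real.negMulLog (∑ i, f i) ≤ ∑ i, Real.negMulLog (f i) := by
  have : Real.negMulLog (∑ i, f i) = ∑ i, -(f i * Real.log (∑ i, f i)) := by
    rw [Real.negMulLog, Finset.sum_neg_distrib, ← Finset.sum_mul]; ring
  rw [this]
  refine Finset.sum_le_sum fun i _ => ?_
  rcases (hf i).eq_or_lt with h | h
  · simp [← h]
  · have h1 : f i ≤ ∑ i, f i := Finset.single_le_sum (fun i _ => hf i) (Finset.mem_univ i)
    have h2 := Real.log_le_log h h1
    have := mul_le_mul_of_nonneg_left h2 h.le
    rw [Real.negMulLog]; linarith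

lemma aux_sub {ι κ : Type*} [Fintype ι] [Fintype κ] (f : ι → κ → ℝ) (hf : ∀ i j, 0 ≤ f i j) :
    ∑ i, ∑ j, Real.negMulLog (f i j) + Real.negMulLog (∑ i, ∑ j, f i j)
      ≤ ∑ i, Real.negMulLog (∑ j, f i j) + ∑ j, Real.negMulLog (∑ i, f i j) := by
  set T := ∑ i, ∑ j, f i j with hT
  set r : ι → ℝ := fun i => ∑ j, f i j with hr
  set c : κ → ℝ := fun j => ∑ i, f i j with hc
  have hrs : ∑ i, r i = T := rfl
  have hcs : ∑ j, c j = T := Finset.sum_comm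
  have hr0 : ∀ i, 0 ≤ r i := fun i => Finset.sum_nonneg fun j _ => hf i j
  have hc0 : ∀ j, 0 ≤ c j := fun j => Finset.sum_nonneg fun i _ => hf i j
  have hT0 : 0 ≤ T := Finset.sum_nonneg fun i _ => hr0 i
  have key : ∀ i j, Real.negMulLog (f i j) ≤
      -(f i j * Real.log (r i)) - f i j * Real.log (c j) + f i j * Real.log T
        + (r i * c j / T - f i j) := by
    intro i j
    rcases (hf i j).eq_or_lt with h | h
    · rw [← h]
      simp
      exact div_nonneg (mul_nonneg (hr0 i) (hc0 j)) hT0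
    · have h1 : f i j ≤ r i :=
        Finset.single_le_sum (f := fun j => f i j) (fun j _ => hf i j) (Finset.mem_univ j)
      have h2 : f i j ≤ c j :=
        Finset.single_le_sum (f := fun i => f i j) (fun i _ => hf i j) (Finset.mem_univ i)
      have h3 : r i ≤ T := Finset.single_le_sum (f := r) (fun i _ => hr0 i) (Finset.mem_univ i)
      have pr : 0 < r i := by linarith
      have pc : 0 < c j := by linarith
      have pT : 0 < T := by linarith
      have hl := Real.log_le_sub_one_of_pos (x := r i * c j / T / f i j) (by positivity)
      rw [Real.log_div (by positivity) (by positivity), Real.log_div (by positivity) (by positivity),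
        Real.log_mul (by positivity) (by positivity)] at hl
      have := mul_le_mul_of_nonneg_left hl h.le
      have e : f i j * (r i * c j / T / f i j - 1) = r i * c j / T - f i j := by
        field_simp
      rw [e] at this
      rw [Real.negMulLog]; linarith
  have hs := Finset.sum_le_sum fun i (_ : i ∈ Finset.univ) =>
    Finset.sum_le_sum fun j (_ : j ∈ Finset.univ) => key i j
  simp only [Finset.sum_add_distrib, Finset.sum_sub_distrib, Finset.sum_neg_distrib] at hs
  have e1 : ∑ i, ∑ j, f i j * Real.log (r i) = ∑ i, r i * Real.log (r i) := by
    simp only [← Finset.sum_mul, hr]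
  have e2 : ∑ i, ∑ j, f i j * Real.log (c j) = ∑ j, c j * Real.log (c j) := by
    rw [Finset.sum_comm]; simp only [← Finset.sum_mul, hc]
  have e3 : ∑ i, ∑ j, f i j * Real.log T = T * Real.log T := by
    simp only [← Finset.sum_mul]; rfl
  have e4 : ∑ i, ∑ j, r i * c j / T = T := by
    simp only [← Finset.sum_div, ← Finset.mul_sum, ← Finset.sum_mul, hrs, hcs]
    exact mul_self_div_self T
  rw [e1, e2, e3, e4] at hs
  simp only [Real.negMulLog, neg_mul, Finset.sum_neg_distrib] at hs ⊢
  linarith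

variable {Ω γ δ ε : Type*} [Fintype Ω] [Fintype γ] [DecidableEq γ]
    [Fintype δ] [DecidableEq δ] [Fintype ε] [DecidableEq ε]

lemma aux_mass_nonneg (μ : Ω → ℝ) (hμ : ∀ ω, 0 ≤ μ ω) (Y : Ω → γ) (y : γ) :
    0 ≤ ∑ ω : Ω, if Y ω = y then μ ω else 0 :=
  Finset.sum_nonneg fun ω _ => by split_ifs <;> simp [hμ]

lemma aux_condEnt_nonneg (μ : Ω → ℝ) (hμ : ∀ ω, 0 ≤ μ ω) (Y : Ω → γ) (Z : Ω → δ) :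
    0 ≤ condEnt μ Y Z := by
  unfold condEnt ent
  rw [sub_nonneg, Fintype.sum_prod_type_right]
  refine Finset.sum_le_sum fun z _ => ?_
  rw [← aux_fst μ Y Z z]
  exact aux_mono _ fun y => aux_mass_nonneg μ hμ _ _

lemma aux_condEnt_le (μ : Ω → ℝ) (hμ : ∀ ω, 0 ≤ μ ω) (Y : Ω → γ) (Z : Ω → δ) (W : Ω → ε) :
    condEnt μ Y (fun ω => (Z ω, W ω)) ≤ condEnt μ Y Z := by
  -- p z y w
  let p : δ → γ → ε → ℝ := fun z y w => ∑ ω : Ω, if (Y ω, Z ω, W ω) = (y, z, w) then μ ω else 0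
  have hw : ∀ z y, ∑ w, p z y w = ∑ ω : Ω, if (Y ω, Z ω) = (y, z) then μ ω else 0 := by
    intro z y
    rw [← aux_fst μ W (fun ω => (Y ω, Z ω)) (y, z)]
    refine Finset.sum_congr rfl fun w _ => Finset.sum_congr rfl fun ω _ => ?_
    congr 1
    simp only [Prod.mk.injEq, eq_iff_iff]; tauto
  have hy : ∀ z w, ∑ y, p z y w = ∑ ω : Ω, if (Z ω, W ω) = (z, w) then μ ω else 0 :=
    fun z w => aux_fst μ Y (fun ω => (Z ω, W ω)) (z, w)
  have hz : ∀ z, ∑ y, ∑ w, p z y w = ∑ ω : Ω, if Z ω = z then μ ω else 0 := by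
    intro z
    simp only [hw]
    exact aux_fst μ Y Z z
  have hs := Finset.sum_le_sum fun z (_ : z ∈ Finset.univ) =>
    aux_sub (p z) fun y w => aux_mass_nonneg μ hμ _ _
  simp only [Finset.sum_add_distrib, hw, hy, aux_fst μ Y Z] at hs
  have E1 : ent μ (fun ω => (Y ω, Z ω, W ω)) = ∑ z, ∑ y, ∑ w, Real.negMulLog (p z y w) := by
    unfold ent
    simp only [Fintype.sum_prod_type]
    rw [Finset.sum_comm]
  have E2 : ent μ (fun ω => (Y ω, Z ω)) =
      ∑ z, ∑ y, Real.negMulLog (∑ ω : Ω, if (Y ω, Z ω) = (y, z) then μ ω else 0) := by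
    unfold ent
    rw [Fintype.sum_prod_type_right]
  have E3 : ent μ (fun ω => (Z ω, W ω)) =
      ∑ z, ∑ w, Real.negMulLog (∑ ω : Ω, if (Z ω, W ω) = (z, w) then μ ω else 0) := by
    unfold ent
    rw [Fintype.sum_prod_type]
  unfold condEnt
  rw [E1, E2, E3]
  unfold ent
  linarith

lemma aux_main {d : ℕ} {α : Type*} [Fintype α] [DecidableEq α]
    (μ : Ω → ℝ) (hμ : ∀ ω, 0 ≤ μ ω) (X : Fin d → Ω → α) (lam : ℝ) (i j : Fin d)
    (h1 : condEnt μ (X i) (X j) ≤ lam) (h2 : condEnt μ (X j) (X i) ≤ lam)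
    (P : Finset (Fin d)) (hi : i ∉ P) :
    |famEnt μ X i P - famEnt μ X j (P.image (Equiv.swap i j))| ≤ lam := by
  have hmem : ∀ (u v : Fin d) (Q : Finset (Fin d)), v ∈ Q →
      famEnt μ X u Q ≤ condEnt μ (X u) (X v) := by
    intro u v Q hv
    refine le_trans (le_of_eq ?_) (aux_condEnt_le μ hμ (X u) (X v) (tupleOf X Q))
    unfold famEnt condEnt
    have a1 := aux_ent_inj μ (tupleOf X Q) (fun ω => (X v ω, tupleOf X Q ω))
      (fun t => (t ⟨v, hv⟩, t)) (fun s t h => (Prod.ext_iff.1 h).2) (fun ω => rfl)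
    have a2 := aux_ent_inj μ (fun ω => (X u ω, tupleOf X Q ω))
      (fun ω => (X u ω, X v ω, tupleOf X Q ω))
      (fun t => (t.1, t.2 ⟨v, hv⟩, t.2))
      (fun s t h => by simp only [Prod.mk.injEq] at h; exact Prod.ext h.1 h.2.2) (fun ω => rfl)
    rw [a1, a2]
  by_cases hj : j ∈ P
  · have b1 := hmem i j P hj
    have b2 := hmem j i (P.image (Equiv.swap i j)) (Finset.mem_image.2 ⟨j, hj, by simp⟩)
    have b3 : 0 ≤ famEnt μ X i P := aux_condEnt_nonneg μ hμ _ _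
    have b4 : 0 ≤ famEnt μ X j (P.image (Equiv.swap i j)) := aux_condEnt_nonneg μ hμ _ _
    rw [abs_le]; constructor <;> linarith
  · have hP : P.image (Equiv.swap i j) = P := by
      have : ∀ x ∈ P, Equiv.swap i j x = x := fun x hx =>
        Equiv.swap_apply_of_ne_of_ne (fun h => hi (h ▸ hx)) (fun h => hj (h ▸ hx))
      rw [Finset.image_congr (g := id) (fun x hx => this x hx), Finset.image_id]
    rw [hP]
    have c1 := aux_condEnt_le μ hμ (X i) (X j) (tupleOf X P)
    have c2 := aux_condEnt_le μ hμ (X j) (X i) (tupleOf X P)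
    have c3 := aux_condEnt_nonneg μ hμ (X i) (fun ω => (X j ω, tupleOf X P ω))
    have c4 := aux_condEnt_nonneg μ hμ (X j) (fun ω => (X i ω, tupleOf X P ω))
    have c5 := aux_ent_inj μ (fun ω => (X i ω, X j ω, tupleOf X P ω))
      (fun ω => (X j ω, X i ω, tupleOf X P ω)) (fun t => (t.2.1, t.1, t.2.2))
      (fun s t h => by
        simp only [Prod.mk.injEq] at h; exact Prod.ext h.2.1 (Prod.ext h.1 h.2.2)) (fun ω => rfl)
    have d1 := c1.trans h1
    have d2 := c2.trans h2
    unfold famEnt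
    unfold condEnt at c3 c4 d1 d2 ⊢
    rw [abs_le]; constructor <;> linarith

end Aux

theorem swapped_family_pair_score_close
    {d k : ℕ} {Ω α : Type*} [Fintype Ω] [Fintype α] [DecidableEq α]
    (hd : 1 ≤ d) (hk : 1 ≤ k)
    (μ : Ω → ℝ) (hμ : IsPMF μ) (X : Fin d → Ω → α)
    (lam : ℝ) (hlam : 0 < lam) (a b : Fin d) (hab : a ≠ b)
    (hnc : NoisyCopy μ X a b lam)
    (Pa Pb : Finset (Fin d)) (haPa : a ∉ Pa) (hbPb : b ∉ Pb)
    (hka : Pa.card ≤ k) (hkb : Pb.card ≤ k) :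
    |(-(famEnt μ X a Pa + famEnt μ X b Pb)) -
        (-(famEnt μ X a (Pb.image (Equiv.swap a b)) +
           famEnt μ X b (Pa.image (Equiv.swap a b))))| ≤ 2 * lam := by
  have h1 := aux_main μ hμ.1 X lam a b hnc.2.2 hnc.2.1 Pa haPa
  have h2 := aux_main μ hμ.1 X lam b a hnc.2.1 hnc.2.2 Pb hbPb
  rw [Equiv.swap_comm b a] at h2
  rw [abs_le] at h1 h2 ⊢
  constructor <;> linarith [h1.1, h1.2, h2.1, h2.2]
end
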